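/- There exists a constant C > 0 depending only on a, b and β such that for every Lipschitz V : closure(Ω) → ℝ with a ≤ V ≤ b and Lipschitz constant ‖∇V‖_∞ ≤ (β+1)a/2, and every classical solution u of problem (P_β) relative to V, one has ∫_{C(1)} (∂_ν u)² dσ ≤ C, |∫_{C(1)} ∂_ν u dσ| ≤ C, and |∫_{C(1/2)} ∂_ν u dσ| ≤ C, where ν is the outward unit normal of Ω (ν(x) = x on C(1), ν(x) = -2x on C(1/2)), ∂_ν u = ∇u·ν, and dσ is arc-length measure. -/

import Mathlib

open MeasureTheory Real RealInnerProductSpace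

noncomputable section

/-- The Euclidean plane ℝ². -/
abbrev E2 := EuclideanSpace ℝ (Fin 2)

/-- The open annulus `{x : R₂ < |x| < R₁}` centered at the origin. -/
def ann (R₂ R₁ : ℝ) : Set E2 := {x : E2 | R₂ < ‖x‖ ∧ ‖x‖ < R₁}

/-- `Ω`, the open annulus of radii 1/2 and 1 centered at the origin. -/
def Omega : Set E2 := ann (1/2) 1

/-- The Laplacian `Δ = ∂₁₁ + ∂₂₂` on ℝ². -/
def lap (u : E2 → ℝ) (x : E2) : ℝ :=
  ∑ i : Fin 2,
    iteratedFDeriv ℝ 2 u x ![EuclideanSpace.single i 1, EuclideanSpace.single i 1]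

/-- The point `r (cos θ, sin θ)` on the circle of radius `r`. -/
def circlePt (r θ : ℝ) : E2 :=
  (WithLp.equiv 2 (Fin 2 → ℝ)).symm ![r * Real.cos θ, r * Real.sin θ]

/-- Arc-length integral of `f` over the circle `C(r) = {x : |x| = r}` centered at the origin:
`∫_{C(r)} f dσ = ∫_0^{2π} f(r cos θ, r sin θ) r dθ`. -/
def circleIntR (f : E2 → ℝ) (r : ℝ) : ℝ := ∫ θ in (0:ℝ)..(2 * π), f (circlePt r θ) * r

/-- A classical solution of problem (P): `u ∈ C²(closure Ω)`, `u = 0` on `∂Ω`, and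
`-Δu = (1 + |x - x₀|^{2β}) V e^u` in `Ω`. -/
def IsSolP (β : ℝ) (x₀ : E2) (V u : E2 → ℝ) : Prop :=
  ContDiffOn ℝ 2 u (closure Omega) ∧
  (∀ x ∈ frontier Omega, u x = 0) ∧
  ∀ x ∈ Omega, -lap u x = (1 + ‖x - x₀‖ ^ (2 * β)) * V x * Real.exp (u x)

/-- A classical solution of problem (P_β): `u ∈ C²(closure Ω)`, `u = 0` on `∂Ω`, and
`-Δu = |x - x₀|^{2β} V e^u` in `Ω`. -/
def IsSolPbeta (β : ℝ) (x₀ : E2) (V u : E2 → ℝ) : Prop :=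
  ContDiffOn ℝ 2 u (closure Omega) ∧
  (∀ x ∈ frontier Omega, u x = 0) ∧
  ∀ x ∈ Omega, -lap u x = ‖x - x₀‖ ^ (2 * β) * V x * Real.exp (u x)

open Set Filter Topology

/-! ### Calculus lemmas on strips -/

lemma strip_slice {E : Type*} [NormedAddCommGroup E] {S : Set ℝ} {f : ℝ → ℝ → E}
    (hf : ContinuousOn (Function.uncurry f) (S ×ˢ univ)) {t : ℝ} (ht : t ∈ S) :
    Continuous (f t) := by
  have h : ContinuousOn (fun θ : ℝ => Function.uncurry f (t, θ)) univ :=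
    hf.comp (by fun_prop) (fun θ _ => ⟨ht, mem_univ _⟩)
  exact continuousOn_univ.1 h

lemma strip_slice' {E : Type*} [NormedAddCommGroup E] {S : Set ℝ} {f : ℝ → ℝ → E}
    (hf : ContinuousOn (Function.uncurry f) (S ×ˢ univ)) (θ : ℝ) :
    ContinuousOn (fun t => f t θ) S :=
  hf.comp (f := fun t : ℝ => (t, θ)) (by fun_prop) (fun t ht => ⟨ht, mem_univ _⟩)

lemma strip_integral_cont {E : Type*} [NormedAddCommGroup E] [NormedSpace ℝ E]
    {A B : ℝ} (hAB : A ≤ B) {f : ℝ → ℝ → E}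
    (hf : ContinuousOn (Function.uncurry f) (Icc A B ×ˢ univ)) (a b : ℝ) :
    ContinuousOn (fun t => ∫ θ in a..b, f t θ) (Icc A B) := by
  have h1 : Continuous (Function.uncurry (fun (t : ℝ) (θ : ℝ) => f (projIcc A B hAB t) θ)) := by
    have : ContinuousOn (fun p : ℝ × ℝ => Function.uncurry f ((projIcc A B hAB p.1 : ℝ), p.2))
        univ := by
      refine hf.comp (f := fun p : ℝ × ℝ => ((projIcc A B hAB p.1 : ℝ), p.2)) ?_ ?_
      · exact (Continuous.prodMk (continuous_subtype_val.comp
          (continuous_projIcc.comp continuous_fst)) continuous_snd).continuousOn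
      · intro p _
        exact ⟨(projIcc A B hAB p.1).2, mem_univ _⟩
    exact continuousOn_univ.1 this
  have h2 := intervalIntegral.continuous_parametric_intervalIntegral_of_continuous'
    (μ := volume) h1 a b
  refine h2.continuousOn.congr ?_
  intro t ht
  simp only [projIcc_of_mem hAB ht]

lemma strip_hasDerivAt {E : Type*} [NormedAddCommGroup E] [NormedSpace ℝ E]
    {A B : ℝ} {f f' : ℝ → ℝ → E}
    (hf : ContinuousOn (Function.uncurry f) (Ioo A B ×ˢ univ))
    (hf' : ContinuousOn (Function.uncurry f') (Ioo A B ×ˢ univ))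
    (hd : ∀ t ∈ Ioo A B, ∀ θ, HasDerivAt (fun t => f t θ) (f' t θ) t)
    (a b : ℝ) {t : ℝ} (ht : t ∈ Ioo A B) :
    HasDerivAt (fun t => ∫ θ in a..b, f t θ) (∫ θ in a..b, f' t θ) t := by
  obtain ⟨ε, hε, hball⟩ := Metric.nhds_basis_closedBall.mem_iff.1 (isOpen_Ioo.mem_nhds ht)
  have hK : IsCompact (Metric.closedBall t ε ×ˢ uIcc a b) :=
    (isCompact_closedBall t ε).prod isCompact_uIcc
  have hsub : Metric.closedBall t ε ×ˢ uIcc a b ⊆ Ioo A B ×ˢ (univ : Set ℝ) :=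
    prod_mono hball (subset_univ _)
  obtain ⟨M, hM⟩ := hK.exists_bound_of_continuousOn (hf'.mono hsub)
  refine (intervalIntegral.hasDerivAt_integral_of_dominated_loc_of_deriv_le
    (F := f) (F' := f') (bound := fun _ => M)
    (Metric.closedBall_mem_nhds t hε) ?_ ?_ ?_ ?_ ?_ ?_).2
  · filter_upwards [isOpen_Ioo.mem_nhds ht] with s hs
    exact (strip_slice hf hs).aestronglyMeasurable
  · exact (strip_slice hf ht).intervalIntegrable _ _
  · exact (strip_slice hf' ht).aestronglyMeasurable
  · refine Eventually.of_forall fun θ hθ s hs => ?_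
    exact hM (s, θ) ⟨hs, uIoc_subset_uIcc hθ⟩
  · exact intervalIntegrable_const
  · exact Eventually.of_forall fun θ hθ s hs => hd s (hball hs) θ

lemma strip_swap {A B : ℝ} (hAB : A ≤ B) {f : ℝ → ℝ → ℝ}
    (hf : ContinuousOn (Function.uncurry f) (Icc A B ×ˢ univ)) (a b : ℝ) :
    ∫ t in A..B, ∫ θ in a..b, f t θ = ∫ θ in a..b, ∫ t in A..B, f t θ := by
  apply intervalIntegral_intervalIntegral_swap
  have hK : IsCompact (Icc A B ×ˢ uIcc a b) := isCompact_Icc.prod isCompact_uIcc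
  refine ((hf.mono (prod_mono le_rfl (subset_univ _))).integrableOn_compact hK).mono_set ?_
  rw [uIoc_of_le hAB]
  exact prod_mono Ioc_subset_Icc_self uIoc_subset_uIcc

/-- One-dimensional integration by parts inequality with a monotone weight. -/
lemma mono_ibp {a b : ℝ} (hab : a ≤ b) {H Y Y' : ℝ → ℝ}
    (hH : ContinuousOn H (Icc a b)) (hmono : MonotoneOn H (Icc a b))
    (hY : ContinuousOn Y (Icc a b)) (hY' : ContinuousOn Y' (Icc a b))
    (hd : ∀ t ∈ Ioo a b, HasDerivAt Y (Y' t) t)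
    (hY0 : ∀ t ∈ Icc a b, 0 ≤ Y t) :
    ∫ t in a..b, H t * Y' t ≤ H b * Y b - H a * Y a := by
  obtain ⟨M, hM⟩ := isCompact_Icc.exists_bound_of_continuousOn hY'
  have hM0 : 0 ≤ M := (norm_nonneg _).trans (hM a ⟨le_rfl, hab⟩)
  have hitg : ∀ x ∈ Icc a b, ∀ z ∈ Icc a b, IntervalIntegrable (fun t => H t * Y' t) volume x z := by
    intro x hx z hz
    exact ((hH.mul hY').mono (uIcc_subset_Icc hx hz)).intervalIntegrable
  have hitg' : ∀ x ∈ Icc a b, ∀ z ∈ Icc a b, IntervalIntegrable Y' volume x z := by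
    intro x hx z hz
    exact (hY'.mono (uIcc_subset_Icc hx hz)).intervalIntegrable
  have haI : a ∈ Icc a b := ⟨le_rfl, hab⟩
  have key := image_le_of_liminf_slope_right_le_deriv_boundary
    (f := fun t => (∫ τ in a..t, H τ * Y' τ) - H t * Y t) (a := a) (b := b)
    (B := fun _ => - (H a * Y a)) (B' := fun _ => 0) ?_ ?_ continuousOn_const ?_ ?_
  · have := key ⟨hab, le_rfl⟩
    linarith
  · refine ContinuousOn.sub ?_ (hH.mul hY)
    have := intervalIntegral.continuousOn_primitive_interval'
      (hitg a haI b ⟨hab, le_rfl⟩) (left_mem_uIcc)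
    rwa [uIcc_of_le hab] at this
  · simp
  · intro x _
    exact hasDerivWithinAt_const _ _ _
  · intro x hx r hr
    apply Eventually.frequently
    have hxI : x ∈ Icc a b := ⟨hx.1, hx.2.le⟩
    have hHc : Tendsto (fun z => (M * (H z - H x))) (𝓝[>] x) (𝓝 0) := by
      have h1 : Tendsto H (𝓝[>] x) (𝓝 (H x)) := by
        have h2 : Tendsto H (𝓝[Icc a b] x) (𝓝 (H x)) := hH x hxI
        refine h2.mono_left ?_
        rw [← nhdsWithin_Ioc_eq_nhdsGT hx.2]
        exact nhdsWithin_mono _ (fun z hz => ⟨hx.1.trans hz.1.le, hz.2⟩)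
      have := (h1.sub_const (H x)).const_mul M
      simpa using this
    filter_upwards [hHc.eventually (gt_mem_nhds hr), Ioc_mem_nhdsGT hx.2] with z hz1 hz2
    have hzI : z ∈ Icc a b := ⟨hx.1.trans hz2.1.le, hz2.2⟩
    refine lt_of_le_of_lt ?_ hz1
    rw [slope_def_field, div_le_iff₀ (sub_pos.2 hz2.1)]
    have e1 : (∫ τ in a..z, H τ * Y' τ) - ∫ τ in a..x, H τ * Y' τ
        = ∫ τ in x..z, H τ * Y' τ :=
      intervalIntegral.integral_interval_sub_left (hitg a haI z hzI) (hitg a haI x hxI)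
    have e2 : ∫ τ in x..z, Y' τ = Y z - Y x := by
      apply intervalIntegral.integral_eq_sub_of_hasDerivAt_of_le hz2.1.le
      · exact hY.mono (Icc_subset_Icc hx.1 hz2.2)
      · exact fun t ht => hd t ⟨hx.1.trans_lt ht.1, ht.2.trans_le hz2.2⟩
      · exact hitg' x hxI z hzI
    have e3 : (∫ τ in x..z, H τ * Y' τ) - H z * (Y z - Y x)
        = ∫ τ in x..z, (H τ - H z) * Y' τ := by
      rw [← e2, ← intervalIntegral.integral_const_mul, ← intervalIntegral.integral_sub
        (hitg x hxI z hzI) ((hitg' x hxI z hzI).const_mul _)]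
      congr 1
      ext τ
      ring
    have e4 : ∫ τ in x..z, (H τ - H z) * Y' τ ≤ (H z - H x) * M * (z - x) := by
      have := intervalIntegral.norm_integral_le_of_norm_le_const (a := x) (b := z)
        (f := fun τ => (H τ - H z) * Y' τ) (C := (H z - H x) * M) ?_
      · rw [abs_of_pos (sub_pos.2 hz2.1)] at this
        exact (le_abs_self _).trans this
      · intro τ hτ
        rw [uIoc_of_le hz2.1.le] at hτ
        have hτI : τ ∈ Icc a b := ⟨hx.1.trans hτ.1.le, hτ.2.trans hz2.2⟩
        rw [norm_mul]
        have h1 : H x ≤ H τ := hmono hxI hτI hτ.1.le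
        have h2 : H τ ≤ H z := hmono hτI hzI hτ.2
        have h3 : ‖H τ - H z‖ ≤ H z - H x := by
          rw [Real.norm_eq_abs, abs_le]; constructor <;> linarith
        exact mul_le_mul h3 (hM τ hτI) (norm_nonneg _) (by linarith)
    have h5 : 0 ≤ (H z - H x) * Y x :=
      mul_nonneg (sub_nonneg.2 (hmono hxI hzI hz2.1.le)) (hY0 x hxI)
    nlinarith

lemma exp_mono_ibp {a b c : ℝ} (hab : a ≤ b) {G W W' : ℝ → ℝ}
    (hG : ContinuousOn G (Icc a b)) (hmono : MonotoneOn (fun t => exp (c * t) * G t) (Icc a b))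
    (hG0 : ∀ t ∈ Icc a b, 0 ≤ G t)
    (hW : ContinuousOn W (Icc a b)) (hW' : ContinuousOn W' (Icc a b))
    (hd : ∀ t ∈ Ioo a b, HasDerivAt W (W' t) t)
    (hW0 : ∀ t ∈ Icc a b, 0 ≤ W t) :
    ∫ t in a..b, G t * W' t ≤ G b * W b + c * ∫ t in a..b, G t * W t := by
  have key := mono_ibp hab (H := fun t => exp (c * t) * G t) (Y := fun t => exp (-(c * t)) * W t)
    (Y' := fun t => exp (-(c * t)) * W' t - c * (exp (-(c * t)) * W t))
    (by fun_prop) hmono (by fun_prop) (by fun_prop) ?_ ?_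
  · have hE : ∀ t, exp (c * t) * exp (-(c * t)) = 1 := fun t => by
      rw [← Real.exp_add]; simp
    have e1 : ∀ t, exp (c * t) * G t * (exp (-(c * t)) * W' t - c * (exp (-(c * t)) * W t))
        = G t * W' t - c * (G t * W t) := by
      intro t
      linear_combination (G t * W' t - c * (G t * W t)) * hE t
    have e2 : ∀ t, exp (c * t) * G t * (exp (-(c * t)) * W t) = G t * W t := by
      intro t
      linear_combination (G t * W t) * hE t
    simp only [e1, e2] at key
    rw [intervalIntegral.integral_sub, intervalIntegral.integral_const_mul] at key
    · have := mul_nonneg (hG0 a ⟨le_rfl, hab⟩) (hW0 a ⟨le_rfl, hab⟩)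
      linarith
    · exact ContinuousOn.intervalIntegrable (by rw [uIcc_of_le hab]; fun_prop)
    · exact ContinuousOn.intervalIntegrable (by rw [uIcc_of_le hab]; fun_prop)
  · intro t ht
    have h1 : HasDerivAt (fun t => exp (-(c * t))) (exp (-(c * t)) * (-(c * 1))) t :=
      (((hasDerivAt_id t).const_mul c).neg).exp
    exact (h1.mul (hd t ht)).congr_deriv (by ring)
  · intro t ht
    exact mul_nonneg (exp_pos _).le (hW0 t ht)

/-! ### Solutions on a strip -/

/-- Data of a solution of `U_tt + U_ss = - G e^U` on the strip `[A, B] × ℝ`, with the first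
derivatives continuous up to the boundary. -/
structure StripSol (A B : ℝ) (U Ut Us Utt Uts Uss G : ℝ → ℝ → ℝ) : Prop where
  cU : ContinuousOn (Function.uncurry U) (Icc A B ×ˢ univ)
  cUt : ContinuousOn (Function.uncurry Ut) (Icc A B ×ˢ univ)
  cUs : ContinuousOn (Function.uncurry Us) (Icc A B ×ˢ univ)
  cG : ContinuousOn (Function.uncurry G) (Icc A B ×ˢ univ)
  cUtt : ContinuousOn (Function.uncurry Utt) (Ioo A B ×ˢ univ)
  cUts : ContinuousOn (Function.uncurry Uts) (Ioo A B ×ˢ univ)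
  cUss : ContinuousOn (Function.uncurry Uss) (Ioo A B ×ˢ univ)
  dUt : ∀ t ∈ Ioo A B, ∀ θ, HasDerivAt (fun t => U t θ) (Ut t θ) t
  dUs : ∀ t ∈ Ioo A B, ∀ θ, HasDerivAt (fun θ => U t θ) (Us t θ) θ
  dUtt : ∀ t ∈ Ioo A B, ∀ θ, HasDerivAt (fun t => Ut t θ) (Utt t θ) t
  dUts : ∀ t ∈ Ioo A B, ∀ θ, HasDerivAt (fun θ => Ut t θ) (Uts t θ) θ
  dUst : ∀ t ∈ Ioo A B, ∀ θ, HasDerivAt (fun t => Us t θ) (Uts t θ) t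
  dUss : ∀ t ∈ Ioo A B, ∀ θ, HasDerivAt (fun θ => Us t θ) (Uss t θ) θ
  pU : ∀ t ∈ Ioo A B, U t (2 * π) = U t 0
  pUt : ∀ t ∈ Ioo A B, Ut t (2 * π) = Ut t 0
  pUs : ∀ t ∈ Ioo A B, Us t (2 * π) = Us t 0
  eqn : ∀ t ∈ Ioo A B, ∀ θ, Utt t θ + Uss t θ = - (G t θ * exp (U t θ))
  zA : ∀ θ, U A θ = 0
  zB : ∀ θ, U B θ = 0
  zsA : ∀ θ, Us A θ = 0
  zsB : ∀ θ, Us B θ = 0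
  U0 : ∀ t ∈ Icc A B, ∀ θ, 0 ≤ U t θ
  G0 : ∀ t ∈ Icc A B, ∀ θ, 0 ≤ G t θ

/-- mean of a function over the slice -/
def mI (f : ℝ → ℝ → ℝ) (t : ℝ) : ℝ := ∫ θ in (0:ℝ)..(2 * π), f t θ

/-- the character `e^{-ikθ}` -/
def ek (k : ℤ) (θ : ℝ) : ℂ := Complex.exp (-(Complex.I * k * θ))

/-- Fourier coefficient over the slice -/
def fI (k : ℤ) (f : ℝ → ℝ → ℝ) (t : ℝ) : ℂ := ∫ θ in (0:ℝ)..(2 * π), ek k θ * (f t θ : ℂ)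

/-- the nonlinearity -/
def nlF (U G : ℝ → ℝ → ℝ) (t θ : ℝ) : ℝ := G t θ * exp (U t θ)

lemma ek_norm (k : ℤ) (θ : ℝ) : ‖ek k θ‖ = 1 := by
  have : -(Complex.I * k * θ) = ((-(k * θ) : ℝ) : ℂ) * Complex.I := by push_cast; ring
  rw [ek, this, Complex.norm_exp_ofReal_mul_I]

lemma ek_cont (k : ℤ) : Continuous (ek k) := by unfold ek; fun_prop

lemma ek_per (k : ℤ) : ek k (2 * π) = ek k 0 := by
  unfold ek
  have : -(Complex.I * k * ((2 * π : ℝ) : ℂ)) = ((-k : ℤ) : ℂ) * (2 * π * Complex.I) := by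
    push_cast; ring
  rw [this, Complex.exp_int_mul_two_pi_mul_I]
  simp

lemma ek_deriv (k : ℤ) (θ : ℝ) :
    HasDerivAt (ek k) (-(Complex.I * k) * ek k θ) θ := by
  have h : HasDerivAt (fun z : ℂ => Complex.exp (-(Complex.I * k * z)))
      (Complex.exp (-(Complex.I * k * θ)) * (-(Complex.I * k * 1))) (θ : ℂ) :=
    (((hasDerivAt_id (θ : ℂ)).const_mul (Complex.I * k)).neg).cexp
  have h2 := h.comp_ofReal
  exact h2.congr_deriv (by unfold ek; ring)

lemma fI_norm_le {S : Set ℝ} {f : ℝ → ℝ → ℝ}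
    (hf : ContinuousOn (Function.uncurry f) (S ×ˢ univ)) (k : ℤ) {t : ℝ} (ht : t ∈ S)
    (h0 : ∀ θ, 0 ≤ f t θ) : ‖fI k f t‖ ≤ mI f t := by
  unfold fI mI
  refine intervalIntegral.norm_integral_le_of_norm_le (by positivity) ?_
    ((strip_slice hf ht).intervalIntegrable _ _)
  refine Eventually.of_forall fun θ _ => ?_
  rw [norm_mul, ek_norm, one_mul, Complex.norm_real, Real.norm_of_nonneg (h0 θ)]

lemma mI_nonneg {f : ℝ → ℝ → ℝ} {t : ℝ} (h0 : ∀ θ, 0 ≤ f t θ) : 0 ≤ mI f t :=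
  intervalIntegral.integral_nonneg (by positivity) (fun θ _ => h0 θ)

lemma mI_cont {A B : ℝ} (hAB : A ≤ B) {f : ℝ → ℝ → ℝ}
    (hf : ContinuousOn (Function.uncurry f) (Icc A B ×ˢ univ)) :
    ContinuousOn (mI f) (Icc A B) := strip_integral_cont hAB hf _ _

lemma Ioo_prod_sub {A B : ℝ} : Ioo A B ×ˢ (univ : Set ℝ) ⊆ Icc A B ×ˢ univ :=
  prod_mono Ioo_subset_Icc_self le_rfl

lemma ek_mul_cont {S : Set ℝ} {f : ℝ → ℝ → ℝ} (k : ℤ)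
    (hf : ContinuousOn (Function.uncurry f) (S ×ˢ univ)) :
    ContinuousOn (Function.uncurry (fun t θ => ek k θ * (f t θ : ℂ))) (S ×ˢ univ) :=
  ((ek_cont k).comp continuous_snd).continuousOn.mul
    (Complex.continuous_ofReal.comp_continuousOn hf)

lemma cPhi_aux {S : Set ℝ} {f g : ℝ → ℝ → ℝ}
    (hf : ContinuousOn (Function.uncurry f) (S ×ˢ univ))
    (hg : ContinuousOn (Function.uncurry g) (S ×ˢ univ)) :
    ContinuousOn (Function.uncurry (fun t θ => f t θ ^ 2 - g t θ ^ 2)) (S ×ˢ univ) := by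
  refine ((hf.mul hf).sub (hg.mul hg)).congr (fun p _ => ?_)
  simp only [Function.uncurry, Pi.mul_apply, Pi.sub_apply]
  ring

namespace StripSol

variable {A B : ℝ} {U Ut Us Utt Uts Uss G : ℝ → ℝ → ℝ}

lemma cF (h : StripSol A B U Ut Us Utt Uts Uss G) :
    ContinuousOn (Function.uncurry (nlF U G)) (Icc A B ×ˢ univ) :=
  h.cG.mul (Real.continuous_exp.comp_continuousOn h.cU)

lemma F0 (h : StripSol A B U Ut Us Utt Uts Uss G) {t : ℝ} (ht : t ∈ Icc A B) (θ : ℝ) :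
    0 ≤ nlF U G t θ := mul_nonneg (h.G0 t ht θ) (exp_pos _).le

lemma dm (h : StripSol A B U Ut Us Utt Uts Uss G) {t : ℝ} (ht : t ∈ Ioo A B) :
    HasDerivAt (mI U) (mI Ut t) t :=
  strip_hasDerivAt (h.cU.mono Ioo_prod_sub) (h.cUt.mono Ioo_prod_sub) h.dUt _ _ ht

lemma dm1 (h : StripSol A B U Ut Us Utt Uts Uss G) {t : ℝ} (ht : t ∈ Ioo A B) :
    HasDerivAt (mI Ut) (- mI (nlF U G) t) t := by
  have h1 : HasDerivAt (mI Ut) (mI Utt t) t :=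
    strip_hasDerivAt (h.cUt.mono Ioo_prod_sub) h.cUtt h.dUtt _ _ ht
  refine h1.congr_deriv ?_
  have h2 : ∫ θ in (0:ℝ)..(2 * π), Uss t θ = 0 := by
    rw [intervalIntegral.integral_eq_sub_of_hasDerivAt (f := fun θ => Us t θ)
      (fun θ _ => h.dUss t ht θ) ((strip_slice h.cUss ht).intervalIntegrable _ _), h.pUs t ht,
      sub_self]
  have h3 : mI Utt t + (∫ θ in (0:ℝ)..(2 * π), Uss t θ) = - mI (nlF U G) t := by
    unfold mI
    rw [← intervalIntegral.integral_neg,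
      ← intervalIntegral.integral_add ((strip_slice h.cUtt ht).intervalIntegrable _ _)
      ((strip_slice h.cUss ht).intervalIntegrable _ _)]
    exact intervalIntegral.integral_congr fun θ _ => h.eqn t ht θ
  linarith

lemma duk (h : StripSol A B U Ut Us Utt Uts Uss G) (k : ℤ) {t : ℝ} (ht : t ∈ Ioo A B) :
    HasDerivAt (fI k U) (fI k Ut t) t :=
  strip_hasDerivAt (ek_mul_cont k (h.cU.mono Ioo_prod_sub))
    (ek_mul_cont k (h.cUt.mono Ioo_prod_sub))
    (fun t ht θ => ((h.dUt t ht θ).ofReal_comp).const_mul (ek k θ)) _ _ ht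

lemma duk1 (h : StripSol A B U Ut Us Utt Uts Uss G) (k : ℤ) {t : ℝ} (ht : t ∈ Ioo A B) :
    HasDerivAt (fI k Ut) ((k : ℂ) ^ 2 * fI k U t - fI k (nlF U G) t) t := by
  have h1 : HasDerivAt (fI k Ut) (fI k Utt t) t :=
    strip_hasDerivAt (ek_mul_cont k (h.cUt.mono Ioo_prod_sub))
      (ek_mul_cont k h.cUtt)
      (fun t ht θ => ((h.dUtt t ht θ).ofReal_comp).const_mul (ek k θ)) _ _ ht
  refine h1.congr_deriv ?_
  have iU := (strip_slice (ek_mul_cont k h.cU) (Ioo_subset_Icc_self ht)).intervalIntegrable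
    (μ := volume) 0 (2 * π)
  have iF := (strip_slice (ek_mul_cont k h.cF) (Ioo_subset_Icc_self ht)).intervalIntegrable
    (μ := volume) 0 (2 * π)
  have iss := (strip_slice (ek_mul_cont k h.cUss) ht).intervalIntegrable (μ := volume) 0 (2 * π)
  have itt := (strip_slice (ek_mul_cont k h.cUtt) ht).intervalIntegrable (μ := volume) 0 (2 * π)
  have h2 : ∫ θ in (0:ℝ)..(2 * π), (ek k θ * (Uss t θ : ℂ) + (k : ℂ) ^ 2 * (ek k θ * (U t θ : ℂ)))
      = 0 := by
    rw [intervalIntegral.integral_eq_sub_of_hasDerivAt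
      (f := fun θ => ek k θ * (Us t θ : ℂ) - (-(Complex.I * k) * ek k θ) * (U t θ : ℂ))]
    · simp only [ek_per, h.pUs t ht, h.pU t ht, sub_self]
    · intro θ _
      have d1 := (ek_deriv k θ).mul (h.dUss t ht θ).ofReal_comp
      have d2 := ((ek_deriv k θ).const_mul (-(Complex.I * k))).mul (h.dUs t ht θ).ofReal_comp
      refine (d1.sub d2).congr_deriv ?_
      linear_combination (-(k : ℂ) ^ 2 * ek k θ * (U t θ : ℂ)) * Complex.I_sq
    · exact iss.add (iU.const_mul _)
  rw [intervalIntegral.integral_add iss (iU.const_mul _),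
    intervalIntegral.integral_const_mul] at h2
  have h3 : fI k Utt t + (∫ θ in (0:ℝ)..(2 * π), ek k θ * (Uss t θ : ℂ)) = - fI k (nlF U G) t := by
    unfold fI
    rw [← intervalIntegral.integral_neg, ← intervalIntegral.integral_add itt iss]
    refine intervalIntegral.integral_congr fun θ _ => ?_
    have := h.eqn t ht θ
    have e : (Utt t θ : ℂ) + (Uss t θ : ℂ) = -((nlF U G t θ : ℝ) : ℂ) := by
      rw [← Complex.ofReal_add, this]; simp [nlF]
    rw [← mul_add, e]; ring
  have h4 : fI k U t = ∫ θ in (0:ℝ)..(2 * π), ek k θ * (U t θ : ℂ) := rfl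
  rw [← h4] at h2
  linear_combination h3 - h2

lemma dPhi (h : StripSol A B U Ut Us Utt Uts Uss G) {t : ℝ} (ht : t ∈ Ioo A B) :
    HasDerivAt (mI (fun t θ => Ut t θ ^ 2 - Us t θ ^ 2))
      (- 2 * mI (fun t θ => Ut t θ * nlF U G t θ) t) t := by
  have cUt := h.cUt.mono (Ioo_prod_sub (A := A) (B := B))
  have cUs := h.cUs.mono (Ioo_prod_sub (A := A) (B := B))
  have h1 : HasDerivAt (mI (fun t θ => Ut t θ ^ 2 - Us t θ ^ 2))
      (mI (fun t θ => 2 * (Ut t θ * Utt t θ - Us t θ * Uts t θ)) t) t :=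
    strip_hasDerivAt (f := fun t θ => Ut t θ ^ 2 - Us t θ ^ 2)
      (f' := fun t θ => 2 * (Ut t θ * Utt t θ - Us t θ * Uts t θ))
      (cPhi_aux cUt cUs)
      ((((cUt.mul h.cUtt).sub (cUs.mul h.cUts)).const_smul (2 : ℝ)).congr (fun p _ => rfl))
      (fun t ht θ => (((h.dUtt t ht θ).pow 2).sub ((h.dUst t ht θ).pow 2)).congr_deriv
        (by push_cast; ring)) _ _ ht
  refine h1.congr_deriv ?_
  have cs := strip_slice cUs ht
  have ct := strip_slice cUt ht
  have css := strip_slice h.cUss ht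
  have ctt := strip_slice h.cUtt ht
  have cts := strip_slice h.cUts ht
  have h2 : ∫ θ in (0:ℝ)..(2 * π), (Uts t θ * Us t θ + Ut t θ * Uss t θ) = 0 := by
    rw [intervalIntegral.integral_eq_sub_of_hasDerivAt (f := fun θ => Ut t θ * Us t θ)
      (fun θ _ => (h.dUts t ht θ).mul (h.dUss t ht θ))
      (Continuous.intervalIntegrable (by fun_prop) _ _), h.pUs t ht, h.pUt t ht,
      sub_self]
  have h3 : mI (fun t θ => 2 * (Ut t θ * Utt t θ - Us t θ * Uts t θ)) t
      + 2 * (∫ θ in (0:ℝ)..(2 * π), (Uts t θ * Us t θ + Ut t θ * Uss t θ))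
      = - 2 * mI (fun t θ => Ut t θ * nlF U G t θ) t := by
    unfold mI
    rw [← intervalIntegral.integral_const_mul, ← intervalIntegral.integral_const_mul,
      ← intervalIntegral.integral_add (Continuous.intervalIntegrable (by fun_prop) _ _)
        (Continuous.intervalIntegrable (by fun_prop) _ _)]
    refine intervalIntegral.integral_congr fun θ _ => ?_
    have := h.eqn t ht θ
    simp only [nlF]
    linear_combination 2 * Ut t θ * this
  linarith

/-- reflection of the strip -/
lemma reflect (h : StripSol A B U Ut Us Utt Uts Uss G) :
    StripSol A B (fun t => U (A + B - t)) (fun t θ => - Ut (A + B - t) θ)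
      (fun t => Us (A + B - t)) (fun t => Utt (A + B - t)) (fun t θ => - Uts (A + B - t) θ)
      (fun t => Uss (A + B - t)) (fun t => G (A + B - t)) := by
  have mI' : ∀ t ∈ Icc A B, A + B - t ∈ Icc A B := fun t ht =>
    ⟨by linarith [ht.2], by linarith [ht.1]⟩
  have mO : ∀ t ∈ Ioo A B, A + B - t ∈ Ioo A B := fun t ht =>
    ⟨by linarith [ht.2], by linarith [ht.1]⟩
  have cI : ∀ f : ℝ → ℝ → ℝ, ContinuousOn (Function.uncurry f) (Icc A B ×ˢ univ) →
      ContinuousOn (Function.uncurry (fun t => f (A + B - t))) (Icc A B ×ˢ univ) := by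
    intro f hf
    exact hf.comp (f := fun p : ℝ × ℝ => (A + B - p.1, p.2)) (by fun_prop)
      (fun p hp => ⟨mI' _ hp.1, mem_univ _⟩)
  have cO : ∀ f : ℝ → ℝ → ℝ, ContinuousOn (Function.uncurry f) (Ioo A B ×ˢ univ) →
      ContinuousOn (Function.uncurry (fun t => f (A + B - t))) (Ioo A B ×ˢ univ) := by
    intro f hf
    exact hf.comp (f := fun p : ℝ × ℝ => (A + B - p.1, p.2)) (by fun_prop)
      (fun p hp => ⟨mO _ hp.1, mem_univ _⟩)
  have dd : ∀ (f : ℝ → ℝ) (f' t : ℝ), HasDerivAt f f' (A + B - t) →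
      HasDerivAt (fun t => f (A + B - t)) (-f') t := by
    intro f f' t hf
    have h2 : HasDerivAt (fun t : ℝ => A + B - t) (-1) t := by
      simpa using (hasDerivAt_id t).const_sub (A + B)
    exact (hf.comp t h2).congr_deriv (by ring)
  refine ⟨cI _ h.cU, (cI _ h.cUt).neg, cI _ h.cUs, cI _ h.cG, cO _ h.cUtt, (cO _ h.cUts).neg,
    cO _ h.cUss, ?_, ?_, ?_, ?_, ?_, ?_, ?_, ?_, ?_, ?_, ?_, ?_, ?_, ?_, ?_, ?_⟩
  · exact fun t ht θ => dd (fun t => U t θ) _ _ (h.dUt _ (mO t ht) θ)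
  · exact fun t ht θ => h.dUs _ (mO t ht) θ
  · exact fun t ht θ => (dd (fun t => Ut t θ) _ _ (h.dUtt _ (mO t ht) θ)).neg.congr_deriv (by ring)
  · exact fun t ht θ => (h.dUts _ (mO t ht) θ).neg
  · exact fun t ht θ => dd (fun t => Us t θ) _ _ (h.dUst _ (mO t ht) θ)
  · exact fun t ht θ => h.dUss _ (mO t ht) θ
  · exact fun t ht => h.pU _ (mO t ht)
  · exact fun t ht => by simpa using h.pUt _ (mO t ht)
  · exact fun t ht => h.pUs _ (mO t ht)
  · exact fun t ht θ => h.eqn _ (mO t ht) θ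
  · intro θ; simpa using h.zB θ
  · intro θ; simpa using h.zA θ
  · intro θ; simpa using h.zsB θ
  · intro θ; simpa using h.zsA θ
  · exact fun t ht θ => h.U0 _ (mI' t ht) θ
  · exact fun t ht θ => h.G0 _ (mI' t ht) θ

end StripSol

namespace StripSol

variable {A B : ℝ} {U Ut Us Utt Uts Uss G : ℝ → ℝ → ℝ}

lemma int_f0 (h : StripSol A B U Ut Us Utt Uts Uss G) {x y : ℝ} (hx : A ≤ x) (hxy : x ≤ y)
    (hy : y ≤ B) : ∫ t in x..y, mI (nlF U G) t = mI Ut x - mI Ut y := by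
  have hAB : A ≤ B := hx.trans (hxy.trans hy)
  have sub : Icc x y ⊆ Icc A B := Icc_subset_Icc hx hy
  have e := intervalIntegral.integral_eq_sub_of_hasDerivAt_of_le (f := mI Ut)
    (f' := fun t => - mI (nlF U G) t) hxy
    ((mI_cont hAB h.cUt).mono sub)
    (fun t ht => h.dm1 ⟨hx.trans_lt ht.1, ht.2.trans_le hy⟩)
    (ContinuousOn.intervalIntegrable (by
      rw [uIcc_of_le hxy]; exact ((mI_cont hAB h.cF).mono sub).neg))
  rw [intervalIntegral.integral_neg] at e
  linarith

/-- The Pohozaev estimate at the end `A` of the strip. -/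
lemma end_estimate (h : StripSol A B U Ut Us Utt Uts Uss G) {c t₀ : ℝ} (h1 : A ≤ t₀) (h2 : t₀ ≤ B)
    (hmono : ∀ θ, MonotoneOn (fun t => exp (c * t) * G t θ) (Icc A t₀)) :
    mI (fun t θ => Ut t θ ^ 2) A ≤ mI (fun t θ => Ut t θ ^ 2) t₀ + 2 * mI (nlF U G) t₀
      + 2 * c * (mI Ut A - mI Ut t₀) := by
  have hAB : A ≤ B := h1.trans h2
  have sub : Icc A t₀ ⊆ Icc A B := Icc_subset_Icc le_rfl h2
  have sub2 : Icc A t₀ ×ˢ (univ : Set ℝ) ⊆ Icc A B ×ˢ univ := prod_mono sub le_rfl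
  have cUtF : ContinuousOn (Function.uncurry (fun t θ => Ut t θ * nlF U G t θ))
      (Icc A B ×ˢ univ) := h.cUt.mul h.cF
  have e := intervalIntegral.integral_eq_sub_of_hasDerivAt_of_le
    (f := mI (fun t θ => Ut t θ ^ 2 - Us t θ ^ 2))
    (f' := fun t => - 2 * mI (fun t θ => Ut t θ * nlF U G t θ) t) h1
    ((mI_cont hAB (cPhi_aux h.cUt h.cUs)).mono sub)
    (fun t ht => h.dPhi ⟨ht.1, ht.2.trans_le h2⟩)
    (ContinuousOn.intervalIntegrable (by
      rw [uIcc_of_le h1]; exact continuousOn_const.mul ((mI_cont hAB cUtF).mono sub)))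
  rw [intervalIntegral.integral_const_mul] at e
  have eA : mI (fun t θ => Ut t θ ^ 2 - Us t θ ^ 2) A = mI (fun t θ => Ut t θ ^ 2) A := by
    unfold mI
    refine intervalIntegral.integral_congr fun θ _ => ?_
    simp [h.zsA θ]
  have e0 : mI (fun t θ => Ut t θ ^ 2 - Us t θ ^ 2) t₀ ≤ mI (fun t θ => Ut t θ ^ 2) t₀ := by
    have c1 := strip_slice h.cUt (t := t₀) ⟨h1, h2⟩
    have c2 := strip_slice h.cUs (t := t₀) ⟨h1, h2⟩
    unfold mI
    refine intervalIntegral.integral_mono (by positivity)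
      (Continuous.intervalIntegrable (by fun_prop) _ _)
      (Continuous.intervalIntegrable (by fun_prop) _ _) (fun θ => ?_)
    simp only
    nlinarith [sq_nonneg (Us t₀ θ)]
  have main : ∫ t in A..t₀, mI (fun t θ => Ut t θ * nlF U G t θ) t
      ≤ mI (nlF U G) t₀ + c * ∫ t in A..t₀, mI (nlF U G) t := by
    have s1 : ∫ t in A..t₀, mI (fun t θ => Ut t θ * nlF U G t θ) t
        = ∫ θ in (0:ℝ)..(2 * π), ∫ t in A..t₀, Ut t θ * nlF U G t θ :=
      strip_swap h1 (cUtF.mono sub2) _ _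
    have s2 : ∫ t in A..t₀, mI (nlF U G) t
        = ∫ θ in (0:ℝ)..(2 * π), ∫ t in A..t₀, nlF U G t θ :=
      strip_swap h1 (h.cF.mono sub2) _ _
    have swapc : ∀ f : ℝ → ℝ → ℝ, ContinuousOn (Function.uncurry f) (Icc A B ×ˢ univ) →
        ContinuousOn (fun θ => ∫ t in A..t₀, f t θ) (Icc 0 (2 * π)) := by
      intro f hf
      have hp : Continuous (Function.uncurry (fun (θ : ℝ) (t : ℝ) => f (projIcc A B hAB t) θ)) := by
        have : ContinuousOn (fun p : ℝ × ℝ => Function.uncurry f ((projIcc A B hAB p.2 : ℝ), p.1))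
            univ := by
          refine hf.comp (f := fun p : ℝ × ℝ => ((projIcc A B hAB p.2 : ℝ), p.1)) ?_ ?_
          · exact (Continuous.prodMk (continuous_subtype_val.comp
              (continuous_projIcc.comp continuous_snd)) continuous_fst).continuousOn
          · intro p _
            exact ⟨(projIcc A B hAB p.2).2, mem_univ _⟩
        exact continuousOn_univ.1 this
      refine (intervalIntegral.continuous_parametric_intervalIntegral_of_continuous'
        (μ := volume) hp A t₀).continuousOn.congr ?_
      intro θ _
      refine intervalIntegral.integral_congr fun t ht => ?_
      rw [uIcc_of_le h1] at ht
      simp only [projIcc_of_mem hAB (sub ht)]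
    rw [s1, s2]
    unfold mI
    have hpi : (0:ℝ) ≤ 2 * π := by positivity
    rw [← intervalIntegral.integral_const_mul, ← intervalIntegral.integral_add]
    · refine intervalIntegral.integral_mono_on hpi ?_ ?_ ?_
      · exact ContinuousOn.intervalIntegrable (by rw [uIcc_of_le hpi]; exact swapc _ cUtF)
      · refine ((strip_slice h.cF (t := t₀) ⟨h1, h2⟩).intervalIntegrable _ _).add ?_
        exact ContinuousOn.intervalIntegrable (by
          rw [uIcc_of_le hpi]; exact continuousOn_const.mul (swapc _ h.cF))
      · intro θ _
        have cU := (strip_slice' h.cU θ).mono sub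
        have cUt := (strip_slice' h.cUt θ).mono sub
        have := exp_mono_ibp (c := c) h1 (G := fun t => G t θ) (W := fun t => exp (U t θ))
          (W' := fun t => exp (U t θ) * Ut t θ) ((strip_slice' h.cG θ).mono sub) (hmono θ)
          (fun t ht => h.G0 t (sub ht) θ) (by fun_prop) (by fun_prop)
          (fun t ht => (h.dUt t ⟨ht.1, ht.2.trans_le h2⟩ θ).exp)
          (fun t _ => (exp_pos _).le)
        refine le_of_eq_of_le ?_ this
        refine intervalIntegral.integral_congr fun t _ => ?_
        simp only [nlF]
        ring
    · exact (strip_slice h.cF (t := t₀) ⟨h1, h2⟩).intervalIntegrable _ _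
    · exact ContinuousOn.intervalIntegrable (by
          rw [uIcc_of_le hpi]; exact continuousOn_const.mul (swapc _ h.cF))
  rw [h.int_f0 le_rfl h1 h2] at main
  rw [eA] at e
  nlinarith

/-- Interior bound of the mean. -/
lemma mass_bound (h : StripSol A B U Ut Us Utt Uts Uss G) (hAB : A < B) {g : ℝ} (hg : 0 < g)
    (hG : ∀ t ∈ Icc (A + (B - A) / 4) (B - (B - A) / 4), ∀ θ, g ≤ G t θ) :
    ∃ M, 0 ≤ M ∧ M ≤ 1024 * π / (g * (B - A) ^ 2) ∧ (∀ t ∈ Icc A B, mI U t ≤ M) ∧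
      ∀ t ∈ Icc (A + (B - A) / 4) (B - (B - A) / 4), |mI Ut t| ≤ 4 * M / (B - A) := by
  set D := B - A with hD
  have hDpos : 0 < D := sub_pos.2 hAB
  set s := A + D / 4 with hs
  set S := B - D / 4 with hS
  have cm := mI_cont hAB.le h.cU
  have m0 : ∀ t ∈ Icc A B, 0 ≤ mI U t := fun t ht => mI_nonneg (h.U0 t ht)
  obtain ⟨p, hp, hpmax⟩ := isCompact_Icc.exists_isMaxOn (nonempty_Icc.2 hAB.le) cm
  have hmax : ∀ t ∈ Icc A B, mI U t ≤ mI U p := fun t ht => hpmax ht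
  have hM0 := m0 p hp
  have mA : mI U A = 0 := by simp [mI, h.zA]
  have mB : mI U B = 0 := by simp [mI, h.zB]
  have anti : ∀ x ∈ Ioo A B, ∀ y ∈ Ioo A B, x ≤ y → mI Ut y ≤ mI Ut x := by
    intro x hx y hy hxy
    have e := h.int_f0 hx.1.le hxy hy.2.le
    have : 0 ≤ ∫ t in x..y, mI (nlF U G) t :=
      intervalIntegral.integral_nonneg hxy (fun t ht => mI_nonneg
        (h.F0 ⟨hx.1.le.trans ht.1, ht.2.trans hy.2.le⟩))
    linarith
  have conc : ConcaveOn ℝ (Icc A B) (mI U) := by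
    apply AntitoneOn.concaveOn_of_deriv (convex_Icc A B) cm
    · rw [interior_Icc]
      exact fun t ht => (h.dm ht).differentiableAt.differentiableWithinAt
    · rw [interior_Icc]
      intro x hx y hy hxy
      rw [(h.dm hx).deriv, (h.dm hy).deriv]
      exact anti x hx y hy hxy
  have hsO : s ∈ Ioo A B := ⟨by linarith, by linarith⟩
  have hSO : S ∈ Ioo A B := ⟨by linarith, by linarith⟩
  have hsS : s ≤ S := by linarith
  have b1 : mI Ut s ≤ 4 * mI U p / D := by
    obtain ⟨ξ, hξ, e⟩ := exists_hasDerivAt_eq_slope (mI U) (mI Ut) hsO.1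
      (cm.mono (Icc_subset_Icc le_rfl hsO.2.le)) (fun t ht => h.dm ⟨ht.1, ht.2.trans hsO.2⟩)
    have := anti ξ ⟨hξ.1, hξ.2.trans hsO.2⟩ s hsO hξ.2.le
    rw [e, mA] at this
    refine this.trans ?_
    have e2 : s - A = D / 4 := by linarith
    rw [e2, div_le_div_iff₀ (by positivity) hDpos]
    nlinarith [hmax s (Ioo_subset_Icc_self hsO)]
  have b2 : - (4 * mI U p / D) ≤ mI Ut S := by
    obtain ⟨ξ, hξ, e⟩ := exists_hasDerivAt_eq_slope (mI U) (mI Ut) hSO.2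
      (cm.mono (Icc_subset_Icc hSO.1.le le_rfl)) (fun t ht => h.dm ⟨hSO.1.trans ht.1, ht.2⟩)
    have := anti S hSO ξ ⟨hSO.1.trans hξ.1, hξ.2⟩ hξ.1.le
    rw [e, mB] at this
    refine le_trans ?_ this
    have e2 : B - S = D / 4 := by linarith
    rw [e2, ← neg_div, div_le_div_iff₀ hDpos (by positivity)]
    nlinarith [hmax S (Ioo_subset_Icc_self hSO)]
  have low : ∀ t ∈ Icc s S, mI U p / 4 ≤ mI U t := by
    intro t ht
    have htO : t ∈ Ioo A B := ⟨hsO.1.trans_le ht.1, ht.2.trans_lt hSO.2⟩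
    rcases le_total p t with hpt | hpt
    · have hpB : 0 < B - p := by linarith [htO.2]
      have := conc.2 hp (right_mem_Icc.2 hAB.le)
        (show 0 ≤ (B - t) / (B - p) from div_nonneg (by linarith [htO.2]) hpB.le)
        (show 0 ≤ (t - p) / (B - p) from div_nonneg (by linarith) hpB.le)
        (by field_simp; ring)
      have e : ((B - t) / (B - p)) • p + ((t - p) / (B - p)) • B = t := by
        simp only [smul_eq_mul]; field_simp; ring
      rw [e, mB] at this
      simp only [smul_eq_mul, mul_zero, add_zero] at this
      refine le_trans ?_ this
      have : 1 / 4 ≤ (B - t) / (B - p) := by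
        rw [div_le_div_iff₀ (by norm_num) hpB]; linarith [ht.2, hp.1]
      nlinarith
    · have hpB : 0 < p - A := by linarith [htO.1]
      have := conc.2 hp (left_mem_Icc.2 hAB.le)
        (show 0 ≤ (t - A) / (p - A) from div_nonneg (by linarith [htO.1]) hpB.le)
        (show 0 ≤ (p - t) / (p - A) from div_nonneg (by linarith) hpB.le)
        (by field_simp; ring)
      have e : ((t - A) / (p - A)) • p + ((p - t) / (p - A)) • A = t := by
        simp only [smul_eq_mul]; field_simp; ring
      rw [e, mA] at this
      simp only [smul_eq_mul, mul_zero, add_zero] at this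
      refine le_trans ?_ this
      have : 1 / 4 ≤ (t - A) / (p - A) := by
        rw [div_le_div_iff₀ (by norm_num) hpB]; linarith [ht.1, hp.2]
      nlinarith
  -- lower bound for `f0`
  have flow : ∀ t ∈ Icc s S, g * mI U p ^ 2 / (64 * π) ≤ mI (nlF U G) t := by
    intro t ht
    have htI : t ∈ Icc A B := ⟨hsO.1.le.trans ht.1, ht.2.trans hSO.2.le⟩
    have hl := low t ht
    set q := mI U t with hq
    have cUt' := strip_slice h.cU htI
    have hpi := pi_pos
    have step : ∫ θ in (0:ℝ)..(2 * π), (g * (q / (2 * π) * U t θ - q ^ 2 / (8 * π ^ 2)))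
        ≤ mI (nlF U G) t := by
      unfold mI
      refine intervalIntegral.integral_mono (by positivity)
        (Continuous.intervalIntegrable (by fun_prop) _ _)
        ((strip_slice h.cF htI).intervalIntegrable _ _) (fun θ => ?_)
      have h1 : U t θ ^ 2 / 2 ≤ exp (U t θ) := by
        have := Real.quadratic_le_exp_of_nonneg (h.U0 t htI θ)
        linarith [h.U0 t htI θ]
      have h2 : q / (2 * π) * U t θ - q ^ 2 / (8 * π ^ 2) ≤ U t θ ^ 2 / 2 := by
        have : q ^ 2 / (8 * π ^ 2) = (q / (2 * π)) ^ 2 / 2 := by field_simp; ring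
        rw [this]
        nlinarith [sq_nonneg (q / (2 * π) - U t θ)]
      have h3 : g * (q / (2 * π) * U t θ - q ^ 2 / (8 * π ^ 2)) ≤ g * exp (U t θ) :=
        mul_le_mul_of_nonneg_left (h2.trans h1) hg.le
      exact h3.trans (mul_le_mul_of_nonneg_right (hG t ht θ) (exp_pos _).le)
    refine le_trans ?_ step
    rw [intervalIntegral.integral_const_mul, intervalIntegral.integral_sub
      (Continuous.intervalIntegrable (by fun_prop) _ _)
      (Continuous.intervalIntegrable (by fun_prop) _ _), intervalIntegral.integral_const_mul,
      intervalIntegral.integral_const]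
    have e : ∫ θ in (0:ℝ)..(2 * π), U t θ = q := rfl
    rw [e]
    have e2 : g * (q / (2 * π) * q - (2 * π - 0) • (q ^ 2 / (8 * π ^ 2))) = g * q ^ 2 / (4 * π) := by
      simp only [smul_eq_mul]; field_simp; ring
    rw [e2, div_le_div_iff₀ (by positivity) (by positivity)]
    have : mI U p ^ 2 ≤ 16 * q ^ 2 := by nlinarith
    nlinarith [mul_le_mul_of_nonneg_left this (mul_pos hg hpi).le]
  have tot : (S - s) * (g * mI U p ^ 2 / (64 * π)) ≤ 8 * mI U p / D := by
    have e := h.int_f0 hsO.1.le hsS hSO.2.le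
    have : ∫ _ in s..S, g * mI U p ^ 2 / (64 * π) ≤ ∫ t in s..S, mI (nlF U G) t :=
      intervalIntegral.integral_mono_on hsS intervalIntegrable_const
        (ContinuousOn.intervalIntegrable (by
          rw [uIcc_of_le hsS]
          exact (mI_cont hAB.le h.cF).mono (Icc_subset_Icc hsO.1.le hSO.2.le))) flow
    rw [intervalIntegral.integral_const, e, smul_eq_mul] at this
    refine this.trans ?_
    have : 8 * mI U p / D = 4 * mI U p / D + 4 * mI U p / D := by ring
    linarith
  refine ⟨mI U p, hM0, ?_, hmax, ?_⟩
  · have e : S - s = D / 2 := by linarith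
    rw [e] at tot
    rw [le_div_iff₀ (by positivity)]
    have hpi := pi_pos
    rcases hM0.eq_or_lt with h0 | h0
    · rw [← h0]; simp; positivity
    · rw [le_div_iff₀ hDpos] at tot
      have e3 : D / 2 * (g * mI U p ^ 2 / (64 * π)) * D
          = mI U p * (g * D ^ 2 * mI U p / (128 * π)) := by field_simp; ring
      rw [e3, mul_comm 8] at tot
      have := le_of_mul_le_mul_left tot h0
      rw [div_le_iff₀ (by positivity)] at this
      linarith
  · intro t ht
    have htO : t ∈ Ioo A B := ⟨hsO.1.trans_le ht.1, ht.2.trans_lt hSO.2⟩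
    rw [abs_le]
    exact ⟨b2.trans (anti t htO S hSO ht.2), (anti s hsO t htO ht.1).trans b1⟩

end StripSol

/-! ### Good slices and Fourier estimates -/

lemma exp_neg_le_rpow {k d : ℝ} (hk : 1 ≤ k) (hd : 0 < d) :
    exp (-(k * d)) ≤ k ^ (-(3/4) : ℝ) * d ^ (-(3/4) : ℝ) := by
  have hkd : 0 < k * d := by positivity
  rw [← Real.mul_rpow (by linarith) hd.le, Real.exp_neg, Real.rpow_neg hkd.le]
  apply inv_anti₀ (by positivity)
  have h2 : k * d + 1 ≤ exp (k * d) := Real.add_one_le_exp _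
  rcases le_total (k * d) 1 with h | h
  · have := Real.rpow_le_one hkd.le h (by norm_num : (0:ℝ) ≤ 3/4)
    linarith
  · have := Real.rpow_le_rpow_of_exponent_le h (by norm_num : (3/4 : ℝ) ≤ 1)
    rw [Real.rpow_one] at this
    linarith

lemma lint_kernel_finite (R : ℝ) :
    ∫⁻ x in Icc (-R) R, ENNReal.ofReal (|x| ^ (-(3/4) : ℝ)) < ⊤ := by
  rcases lt_or_ge R 0 with hR | hR
  · rw [Icc_eq_empty (by linarith)]; simp
  have h1 : IntervalIntegrable (fun x : ℝ => |x| ^ (-(3/4) : ℝ)) volume (-R) R := by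
    have hp : IntervalIntegrable (fun x : ℝ => |x| ^ (-(3/4) : ℝ)) volume 0 R := by
      refine (intervalIntegral.intervalIntegrable_rpow' (a := 0) (b := R)
        (by norm_num : (-1:ℝ) < -(3/4))).congr ?_
      intro x hx
      rw [uIoc_of_le hR] at hx
      simp only [abs_of_pos hx.1]
    have hn : IntervalIntegrable (fun x : ℝ => |x| ^ (-(3/4) : ℝ)) volume (-R) 0 := by
      have := (hp.comp_sub_left 0).symm
      simpa using this
    exact hn.trans hp
  have h2 : IntegrableOn (fun x : ℝ => |x| ^ (-(3/4) : ℝ)) (Icc (-R) R) volume := by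
    rw [integrableOn_Icc_iff_integrableOn_Ioc,
      ← intervalIntegrable_iff_integrableOn_Ioc_of_le (by linarith)]
    exact h1
  exact h2.lintegral_lt_top

lemma good_slice {s S t₁ t₂ N : ℝ} (h1 : s ≤ t₁) (h12 : t₁ < t₂) (h2 : t₂ ≤ S) (hN : 0 ≤ N) :
    ∃ K : ℝ, 0 ≤ K ∧ ∀ f : ℝ → ℝ, ContinuousOn f (Icc s S) → (∀ t ∈ Icc s S, 0 ≤ f t) →
      ∫ t in s..S, f t ≤ N →
      ∃ t₀ ∈ Icc t₁ t₂, f t₀ ≤ K ∧ ∀ k : ℝ, 1 ≤ k →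
        ∫ τ in s..S, exp (-(k * |t₀ - τ|)) * f τ ≤ K * k ^ (-(3/4) : ℝ) := by
  have hsS : s ≤ S := by linarith
  set κ : ℝ → ENNReal := fun x => ENNReal.ofReal (|x| ^ (-(3/4) : ℝ)) with hκ
  have mκ : Measurable κ := by
    refine ENNReal.measurable_ofReal.comp ?_
    exact (measurable_norm (α := ℝ)).pow_const _
  set c0 := ∫⁻ x in Icc (-(S - s)) (S - s), κ x with hc0
  have hc0top : c0 ≠ ⊤ := (lint_kernel_finite (S - s)).ne
  set K := ((1 + c0.toReal) * N + 1) / (t₂ - t₁) with hK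
  have hKpos : 0 < K := div_pos (by positivity) (by linarith)
  refine ⟨K, hKpos.le, ?_⟩
  intro f hf f0 hfN
  set F : ℝ → ℝ := IccExtend hsS ((Icc s S).domRestrict f) with hF
  have cF : Continuous F := (continuousOn_iff_continuous_domRestrict.1 hf).Icc_extend'
  have Feq : ∀ t ∈ Icc s S, F t = f t := fun t ht => by
    rw [hF, IccExtend_of_mem _ _ ht]; rfl
  set φ : ℝ → ENNReal := fun t => ENNReal.ofReal (F t) with hφ
  have mφ : Measurable φ := ENNReal.measurable_ofReal.comp cF.measurable
  have intφ : ∫⁻ t in Icc s S, φ t ≤ ENNReal.ofReal N := by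
    rw [hφ, ← ofReal_integral_eq_lintegral_ofReal]
    · apply ENNReal.ofReal_le_ofReal
      rw [setIntegral_congr_fun measurableSet_Icc Feq, integral_Icc_eq_integral_Ioc,
        ← intervalIntegral.integral_of_le hsS]
      exact hfN
    · exact cF.integrableOn_Icc
    · refine (ae_restrict_iff' measurableSet_Icc).2 (Eventually.of_forall fun t ht => ?_)
      simp only [Pi.zero_apply]
      rw [Feq t ht]; exact f0 t ht
  set J : ℝ → ENNReal := fun t => φ t + ∫⁻ τ in Icc s S, κ (t - τ) * φ τ with hJ
  have mker : Measurable (Function.uncurry fun t τ : ℝ => κ (t - τ) * φ τ) :=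
    (mκ.comp (measurable_fst.sub measurable_snd)).mul (mφ.comp measurable_snd)
  have total : ∫⁻ t in Icc t₁ t₂, J t ≤ (1 + c0) * ENNReal.ofReal N := by
    rw [hJ, lintegral_add_left mφ, add_mul, one_mul]
    refine add_le_add ?_ ?_
    · exact (lintegral_mono_set (Icc_subset_Icc h1 h2)).trans intφ
    · rw [lintegral_lintegral_swap mker.aemeasurable]
      have inner : ∀ τ ∈ Icc s S, ∫⁻ t in Icc t₁ t₂, κ (t - τ) * φ τ ≤ c0 * φ τ := by
        intro τ hτ
        have mt : Measurable (fun t => κ (t - τ)) := mκ.comp (measurable_id.sub_const τ)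
        rw [lintegral_mul_const _ mt]
        refine mul_le_mul_left ?_ _
        calc ∫⁻ t in Icc t₁ t₂, κ (t - τ)
            = ∫⁻ t, (Icc t₁ t₂).indicator (fun t => κ (t - τ)) t :=
              (lintegral_indicator measurableSet_Icc _).symm
          _ ≤ ∫⁻ t, (fun x => (Icc (-(S - s)) (S - s)).indicator κ x) (t - τ) := by
              refine lintegral_mono fun t => ?_
              by_cases ht : t ∈ Icc t₁ t₂
              · have : t - τ ∈ Icc (-(S - s)) (S - s) :=
                  ⟨by linarith [ht.1, hτ.2], by linarith [ht.2, hτ.1]⟩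
                simp only [indicator_of_mem ht, indicator_of_mem this, le_refl]
              · simp only [indicator_of_notMem ht, zero_le]
          _ = ∫⁻ x, (Icc (-(S - s)) (S - s)).indicator κ x :=
              lintegral_sub_right_eq_self (fun x => (Icc (-(S - s)) (S - s)).indicator κ x) τ
          _ = c0 := lintegral_indicator measurableSet_Icc _
      calc ∫⁻ τ in Icc s S, ∫⁻ t in Icc t₁ t₂, κ (t - τ) * φ τ
          ≤ ∫⁻ τ in Icc s S, c0 * φ τ := setLIntegral_mono' measurableSet_Icc inner
        _ = c0 * ∫⁻ τ in Icc s S, φ τ := lintegral_const_mul _ mφ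
        _ ≤ c0 * ENNReal.ofReal N := mul_le_mul_right intφ _
  obtain ⟨t₀, ht₀, hJt⟩ : ∃ t₀ ∈ Icc t₁ t₂, J t₀ ≤ ENNReal.ofReal K := by
    by_contra hcon
    push Not at hcon
    have hlow : ENNReal.ofReal K * volume (Icc t₁ t₂) ≤ ∫⁻ t in Icc t₁ t₂, J t := by
      rw [← setLIntegral_const]
      exact setLIntegral_mono' measurableSet_Icc (fun t ht => (hcon t ht).le)
    have h3 := hlow.trans total
    rw [Real.volume_Icc, ← ENNReal.ofReal_mul hKpos.le] at h3
    have e1 : (1 + c0) * ENNReal.ofReal N = ENNReal.ofReal ((1 + c0.toReal) * N) := by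
      rw [ENNReal.ofReal_mul (by positivity), ENNReal.ofReal_add (by norm_num)
        ENNReal.toReal_nonneg, ENNReal.ofReal_toReal hc0top, ENNReal.ofReal_one]
    have e2 : K * (t₂ - t₁) = (1 + c0.toReal) * N + 1 := by
      rw [hK, div_mul_cancel₀]; linarith
    rw [e1, e2, ENNReal.ofReal_le_ofReal_iff (by positivity)] at h3
    linarith
  have ht₀I : t₀ ∈ Icc s S := ⟨h1.trans ht₀.1, ht₀.2.trans h2⟩
  refine ⟨t₀, ht₀, ?_, ?_⟩
  · have : φ t₀ ≤ ENNReal.ofReal K := le_self_add.trans hJt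
    rw [hφ] at this
    simp only at this
    rw [ENNReal.ofReal_le_ofReal_iff hKpos.le, Feq t₀ ht₀I] at this
    exact this
  · intro k hk
    have hk0 : 0 < k := by linarith
    have hkp : 0 ≤ k ^ (-(3/4) : ℝ) := Real.rpow_nonneg hk0.le _
    have e1 : ∫ τ in s..S, exp (-(k * |t₀ - τ|)) * f τ
        = ∫ τ in Icc s S, exp (-(k * |t₀ - τ|)) * F τ := by
      rw [intervalIntegral.integral_of_le hsS, ← integral_Icc_eq_integral_Ioc]
      exact setIntegral_congr_fun measurableSet_Icc (fun τ hτ => by simp only [Feq τ hτ])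
    have b : ∫⁻ τ in Icc s S, ENNReal.ofReal (exp (-(k * |t₀ - τ|)) * F τ)
        ≤ ENNReal.ofReal (K * k ^ (-(3/4) : ℝ)) := by
      have hne : ∀ᵐ τ ∂(volume.restrict (Icc s S)), τ ≠ t₀ := by
        refine ae_restrict_of_ae ?_
        simp [ae_iff]
      calc ∫⁻ τ in Icc s S, ENNReal.ofReal (exp (-(k * |t₀ - τ|)) * F τ)
          ≤ ∫⁻ τ in Icc s S, ENNReal.ofReal (k ^ (-(3/4) : ℝ)) * (κ (t₀ - τ) * φ τ) := by
            refine lintegral_mono_ae ?_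
            filter_upwards [hne] with τ hτ
            rw [ENNReal.ofReal_mul (exp_pos _).le, ← mul_assoc]
            refine mul_le_mul_left ?_ _
            rw [hκ]
            simp only
            rw [← ENNReal.ofReal_mul hkp]
            exact ENNReal.ofReal_le_ofReal
              (exp_neg_le_rpow hk (abs_pos.2 (sub_ne_zero.2 hτ.symm)))
        _ = ENNReal.ofReal (k ^ (-(3/4) : ℝ)) * ∫⁻ τ in Icc s S, κ (t₀ - τ) * φ τ := by
            refine lintegral_const_mul _ ?_
            exact (mκ.comp (measurable_const.sub measurable_id)).mul mφ
        _ ≤ ENNReal.ofReal (k ^ (-(3/4) : ℝ)) * ENNReal.ofReal K :=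
            mul_le_mul_right (le_add_self.trans hJt) _
        _ = ENNReal.ofReal (K * k ^ (-(3/4) : ℝ)) := by
            rw [← ENNReal.ofReal_mul hkp, mul_comm]
    rw [e1, ← ENNReal.ofReal_le_ofReal_iff (by positivity), ofReal_integral_eq_lintegral_ofReal]
    · exact b
    · exact Continuous.integrableOn_Icc (by fun_prop)
    · refine (ae_restrict_iff' measurableSet_Icc).2 (Eventually.of_forall fun t ht => ?_)
      simp only [Pi.zero_apply]
      rw [Feq t ht]; exact mul_nonneg (exp_pos _).le (f0 t ht)

/-- Variation of constants bound. -/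
lemma ode_bound {c x y : ℝ} {v φ : ℝ → ℂ} (hφ : ContinuousOn φ (uIcc x y))
    (hv : ∀ t ∈ uIcc x y, HasDerivAt v (c * v t - φ t) t) :
    ‖v y‖ ≤ exp (c * (y - x)) * ‖v x‖ + |∫ τ in x..y, exp (c * (y - τ)) * ‖φ τ‖| := by
  have hE : ∀ t : ℝ, HasDerivAt (fun τ : ℝ => ((exp (c * (y - τ)) : ℝ) : ℂ))
      ((exp (c * (y - t)) * (c * (-1)) : ℝ) : ℂ) t := by
    intro t
    have : HasDerivAt (fun τ : ℝ => exp (c * (y - τ))) (exp (c * (y - t)) * (c * (-1))) t := by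
      have h2 : HasDerivAt (fun t : ℝ => y - t) (-1) t := by
        simpa using (hasDerivAt_id t).const_sub y
      exact (h2.const_mul c).exp
    exact this.ofReal_comp
  have e := intervalIntegral.integral_eq_sub_of_hasDerivAt
    (f := fun τ => ((exp (c * (y - τ)) : ℝ) : ℂ) * v τ)
    (f' := fun τ => -(((exp (c * (y - τ)) : ℝ) : ℂ) * φ τ)) (a := x) (b := y)
    (fun t ht => ((hE t).mul (hv t ht)).congr_deriv (by push_cast; ring))
    (ContinuousOn.intervalIntegrable (by
      refine (ContinuousOn.mul ?_ hφ).neg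
      exact Continuous.continuousOn (by fun_prop)))
  rw [intervalIntegral.integral_neg] at e
  simp only [sub_self, mul_zero, Real.exp_zero, Complex.ofReal_one, one_mul] at e
  have e2 : v y = ((exp (c * (y - x)) : ℝ) : ℂ) * v x
      - ∫ τ in x..y, ((exp (c * (y - τ)) : ℝ) : ℂ) * φ τ := by
    linear_combination -e
  rw [e2]
  refine (norm_sub_le _ _).trans (add_le_add ?_ ?_)
  · rw [norm_mul, Complex.norm_real, Real.norm_of_nonneg (exp_pos _).le]
  · refine intervalIntegral.norm_integral_le_abs_integral_norm.trans_eq ?_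
    congr 1
    refine intervalIntegral.integral_congr fun τ _ => ?_
    simp only [norm_mul, Complex.norm_real, Real.norm_of_nonneg (exp_pos _).le]

/-- Derivative bound from the second derivative. -/
lemma taylor_bound {x y : ℝ} {u u' u'' : ℝ → ℂ} (h2 : ContinuousOn u'' (uIcc x y))
    (hu : ∀ t ∈ uIcc x y, HasDerivAt u (u' t) t)
    (hu' : ∀ t ∈ uIcc x y, HasDerivAt u' (u'' t) t) :
    |y - x| * ‖u' x‖ ≤ ‖u y‖ + ‖u x‖ + |y - x| * |∫ τ in x..y, ‖u'' τ‖| := by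
  have e := intervalIntegral.integral_eq_sub_of_hasDerivAt
    (f := fun τ : ℝ => ((y - τ : ℝ) : ℂ) * u' τ + u τ)
    (f' := fun τ : ℝ => ((y - τ : ℝ) : ℂ) * u'' τ) (a := x) (b := y)
    (fun t ht => by
      have h3 : HasDerivAt (fun t : ℝ => ((y - t : ℝ) : ℂ)) ((-1 : ℝ) : ℂ) t := by
        have : HasDerivAt (fun t : ℝ => y - t) (-1) t := by
          simpa using (hasDerivAt_id t).const_sub y
        exact this.ofReal_comp
      exact ((h3.mul (hu' t ht)).add (hu t ht)).congr_deriv (by push_cast; ring))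
    (ContinuousOn.intervalIntegrable (by
      refine ContinuousOn.mul ?_ h2
      exact Continuous.continuousOn (by fun_prop)))
  have e2 : ((y - x : ℝ) : ℂ) * u' x
      = u y - u x - ∫ τ in x..y, ((y - τ : ℝ) : ℂ) * u'' τ := by
    simp only [sub_self, Complex.ofReal_zero, zero_mul, zero_add] at e
    linear_combination e
  have e3 : |y - x| * ‖u' x‖ = ‖((y - x : ℝ) : ℂ) * u' x‖ := by
    rw [norm_mul, Complex.norm_real, Real.norm_eq_abs]
  rw [e3, e2]
  refine (norm_sub_le _ _).trans (add_le_add (norm_sub_le _ _) ?_)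
  rw [intervalIntegral.norm_integral_eq_norm_integral_uIoc]
  have e4 : |y - x| * |∫ τ in x..y, ‖u'' τ‖| = ∫ τ in Set.uIoc x y, |y - x| * ‖u'' τ‖ := by
    rw [integral_const_mul]
    congr 1
    rw [← Real.norm_eq_abs, intervalIntegral.norm_integral_eq_norm_integral_uIoc,
      Real.norm_of_nonneg]
    exact integral_nonneg fun _ => norm_nonneg _
  rw [e4]
  refine norm_integral_le_of_norm_le ?_ ?_
  · refine ((h2.norm.integrableOn_compact isCompact_uIcc).mono_set uIoc_subset_uIcc).const_mul _
  · refine (ae_restrict_iff' measurableSet_uIoc).2 (Eventually.of_forall fun τ hτ => ?_)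
    rw [norm_mul, Complex.norm_real, Real.norm_eq_abs]
    refine mul_le_mul_of_nonneg_right ?_ (norm_nonneg _)
    exact abs_sub_right_of_mem_uIcc (uIoc_subset_uIcc hτ)

lemma abs_integral_le_of_sub {x y s S : ℝ} {g h : ℝ → ℝ} (hx : x ∈ Icc s S) (hy : y ∈ Icc s S)
    (hh : ContinuousOn h (Icc s S)) (h0 : ∀ τ ∈ Icc s S, 0 ≤ h τ)
    (hgh : ∀ τ ∈ uIcc x y, |g τ| ≤ h τ) : |∫ τ in x..y, g τ| ≤ ∫ τ in s..S, h τ := by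
  have hsS : s ≤ S := hx.1.trans hx.2
  have sub : uIcc x y ⊆ Icc s S := by
    rw [← uIcc_of_le hsS]
    exact uIcc_subset_uIcc (by rwa [uIcc_of_le hsS]) (by rwa [uIcc_of_le hsS])
  have subo : Set.uIoc x y ⊆ Ioc s S := fun τ hτ =>
    ⟨lt_of_le_of_lt (le_min hx.1 hy.1) hτ.1, hτ.2.trans (max_le hx.2 hy.2)⟩
  have hitg : IntegrableOn h (Ioc s S) volume :=
    (hh.integrableOn_compact isCompact_Icc).mono_set Ioc_subset_Icc_self
  rw [← Real.norm_eq_abs, intervalIntegral.norm_integral_eq_norm_integral_uIoc,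
    intervalIntegral.integral_of_le hsS]
  calc ‖∫ τ in Set.uIoc x y, g τ‖ ≤ ∫ τ in Set.uIoc x y, h τ := by
        refine norm_integral_le_of_norm_le (hitg.mono_set subo) ?_
        exact (ae_restrict_iff' measurableSet_uIoc).2
          (Eventually.of_forall fun τ hτ => hgh τ (uIoc_subset_uIcc hτ))
    _ ≤ ∫ τ in Ioc s S, h τ := by
        refine setIntegral_mono_set hitg ?_ subo.eventuallyLE
        exact (ae_restrict_iff' measurableSet_Ioc).2
          (Eventually.of_forall fun τ hτ => h0 τ (Ioc_subset_Icc_self hτ))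

lemma fI_cont {A B : ℝ} (hAB : A ≤ B) (k : ℤ) {f : ℝ → ℝ → ℝ}
    (hf : ContinuousOn (Function.uncurry f) (Icc A B ×ˢ univ)) :
    ContinuousOn (fI k f) (Icc A B) := strip_integral_cont hAB (ek_mul_cont k hf) _ _

lemma exp_decay {κ δ R : ℝ} (hκ : 1 ≤ κ) (hδ : 0 < δ) (hR : 0 ≤ R) :
    exp (-(κ * δ)) * (κ ^ 2 * R) ≤ R * (6 / δ ^ 3) * κ ^ (-(3/4) : ℝ) := by
  have hκ0 : 0 < κ := by linarith
  have h1 := Real.pow_div_factorial_le_exp (κ * δ) (by positivity) 3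
  have h2 : exp (-(κ * δ)) ≤ 6 / (κ * δ) ^ 3 := by
    rw [Real.exp_neg, show (6:ℝ) / (κ * δ) ^ 3 = ((κ * δ) ^ 3 / 6)⁻¹ by rw [inv_div]]
    refine inv_anti₀ (by positivity) ?_
    simpa [Nat.factorial] using h1
  have h3 : κ⁻¹ ≤ κ ^ (-(3/4) : ℝ) := by
    rw [← Real.rpow_neg_one]
    exact Real.rpow_le_rpow_of_exponent_le hκ (by norm_num)
  calc exp (-(κ * δ)) * (κ ^ 2 * R) ≤ 6 / (κ * δ) ^ 3 * (κ ^ 2 * R) := by gcongr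
    _ = R * (6 / δ ^ 3) * κ⁻¹ := by field_simp
    _ ≤ _ := by gcongr

namespace StripSol

variable {A B : ℝ} {U Ut Us Utt Uts Uss G : ℝ → ℝ → ℝ}

lemma mode_bound (h : StripSol A B U Ut Us Utt Uts Uss G) {s S δ t₀ M N K : ℝ}
    (hs : A < s) (hS : S < B) (hδ : 0 < δ) (ht1 : s + δ ≤ t₀) (ht2 : t₀ + δ ≤ S) (hM : 0 ≤ M)
    (hUM : ∀ t ∈ Icc A B, mI U t ≤ M) (hN : ∫ t in s..S, mI (nlF U G) t ≤ N)
    (k : ℤ) (hk : 1 ≤ |(k : ℝ)|)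
    (hK : ∫ τ in s..S, exp (-(|(k : ℝ)| * |t₀ - τ|)) * mI (nlF U G) τ
      ≤ K * |(k : ℝ)| ^ (-(3/4) : ℝ)) :
    ‖fI k Ut t₀‖ ≤ ((2 * M / (S - s) + M * (S - s) + N + M) * (6 / δ ^ 3) + K)
      * |(k : ℝ)| ^ (-(3/4) : ℝ) := by
  set κ := |(k : ℝ)| with hκ
  set R := 2 * M / (S - s) + M * (S - s) + N + M with hR
  have hsS : s < S := by linarith
  have hAB : A ≤ B := by linarith
  have subO : Icc s S ⊆ Ioo A B := fun t ht => ⟨hs.trans_le ht.1, ht.2.trans_lt hS⟩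
  have subI : Icc s S ⊆ Icc A B := subO.trans Ioo_subset_Icc_self
  have ms : s ∈ Icc s S := ⟨le_rfl, hsS.le⟩
  have mS : S ∈ Icc s S := ⟨hsS.le, le_rfl⟩
  have mt : t₀ ∈ Icc s S := ⟨by linarith, by linarith⟩
  have kk : (k : ℂ) ^ 2 = (κ : ℂ) ^ 2 := by
    have : (k : ℝ) ^ 2 = κ ^ 2 := (sq_abs _).symm
    exact_mod_cast congrArg (fun x : ℝ => (x : ℂ)) this
  have f0 : ∀ t ∈ Icc s S, 0 ≤ mI (nlF U G) t := fun t ht => mI_nonneg (h.F0 (subI ht))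
  have cf0 : ContinuousOn (mI (nlF U G)) (Icc s S) := (mI_cont hAB h.cF).mono subI
  have cfk : ContinuousOn (fI k (nlF U G)) (Icc s S) := (fI_cont hAB k h.cF).mono subI
  have fk_le : ∀ t ∈ Icc s S, ‖fI k (nlF U G) t‖ ≤ mI (nlF U G) t := fun t ht =>
    fI_norm_le h.cF k (subI ht) (h.F0 (subI ht))
  have uk_le : ∀ t ∈ Icc s S, ‖fI k U t‖ ≤ M := fun t ht =>
    (fI_norm_le h.cU k (subI ht) (h.U0 t (subI ht))).trans (hUM t (subI ht))
  have N0 : 0 ≤ N := (intervalIntegral.integral_nonneg hsS.le f0).trans hN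
  have hℓ : 0 < S - s := by linarith
  have R0 : 0 ≤ R := by positivity
  -- bounds for the derivative at the ends
  have endb : ∀ x ∈ Icc s S, ∀ y ∈ Icc s S, |y - x| = S - s → ‖fI k Ut x‖ + κ * ‖fI k U x‖
      ≤ κ ^ 2 * R := by
    intro x hx y hy hxy
    have sub : uIcc x y ⊆ Icc s S := by
      rw [← uIcc_of_le hsS.le]
      exact uIcc_subset_uIcc (by rwa [uIcc_of_le hsS.le]) (by rwa [uIcc_of_le hsS.le])
    have cu'' : ContinuousOn (fun t => (k : ℂ) ^ 2 * fI k U t - fI k (nlF U G) t) (Icc s S) :=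
      (((fI_cont hAB k h.cU).mono subI).const_smul ((k : ℂ) ^ 2)).sub cfk
    have tb := taylor_bound (x := x) (y := y) (u := fI k U) (u' := fI k Ut)
      (u'' := fun t => (k : ℂ) ^ 2 * fI k U t - fI k (nlF U G) t) (cu''.mono sub)
      (fun t ht => h.duk k (subO (sub ht))) (fun t ht => h.duk1 k (subO (sub ht)))
    have ib : |∫ τ in x..y, ‖(k : ℂ) ^ 2 * fI k U τ - fI k (nlF U G) τ‖|
        ≤ ∫ τ in s..S, (κ ^ 2 * M + mI (nlF U G) τ) := by
      refine abs_integral_le_of_sub hx hy (continuousOn_const.add cf0) ?_ ?_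
      · intro τ hτ
        have := f0 τ hτ
        positivity
      · intro τ hτ
        rw [abs_of_nonneg (norm_nonneg _)]
        refine (norm_sub_le _ _).trans (add_le_add ?_ (fk_le τ (sub hτ)))
        rw [kk, norm_mul, norm_pow, Complex.norm_real, Real.norm_of_nonneg (by positivity)]
        gcongr
        exact uk_le τ (sub hτ)
    rw [intervalIntegral.integral_add (by simp)
      (ContinuousOn.intervalIntegrable (by rw [uIcc_of_le hsS.le]; exact cf0)),
      intervalIntegral.integral_const, smul_eq_mul] at ib
    rw [hxy] at tb
    have u1 := uk_le x hx
    have u2 := uk_le y hy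
    have b1 : (S - s) * ‖fI k Ut x‖ ≤ 2 * M + (S - s) * ((S - s) * (κ ^ 2 * M) + N) := by
      have : (S - s) * |∫ τ in x..y, ‖(k : ℂ) ^ 2 * fI k U τ - fI k (nlF U G) τ‖|
        ≤ (S - s) * ((S - s) * (κ ^ 2 * M) + N) :=
        mul_le_mul_of_nonneg_left (by linarith) hℓ.le
      linarith
    have b2 : ‖fI k Ut x‖ ≤ 2 * M / (S - s) + (S - s) * (κ ^ 2 * M) + N := by
      rw [mul_comm, ← le_div_iff₀ hℓ] at b1
      refine b1.trans_eq ?_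
      field_simp
      ring
    have κ2 : κ ≤ κ ^ 2 := by nlinarith
    have κ1 : 1 ≤ κ ^ 2 := by nlinarith
    have c1 : κ * ‖fI k U x‖ ≤ κ ^ 2 * M := by gcongr
    have c2 : 2 * M / (S - s) ≤ κ ^ 2 * (2 * M / (S - s)) :=
      le_mul_of_one_le_left (by positivity) κ1
    have c3 : N ≤ κ ^ 2 * N := le_mul_of_one_le_left N0 κ1
    rw [hR]
    nlinarith
  have nκ : ∀ z : ℂ, ‖(κ : ℂ) * z‖ = κ * ‖z‖ := fun z => by
    rw [norm_mul, Complex.norm_real, Real.norm_of_nonneg (by positivity)]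
  have ckern : ContinuousOn (fun τ => exp (-(κ * |t₀ - τ|)) * mI (nlF U G) τ) (Icc s S) :=
    ContinuousOn.mul (Continuous.continuousOn (by fun_prop)) cf0
  have kern0 : ∀ τ ∈ Icc s S, 0 ≤ exp (-(κ * |t₀ - τ|)) * mI (nlF U G) τ := fun τ hτ =>
    mul_nonneg (exp_pos _).le (f0 τ hτ)
  have hq : ‖fI k Ut t₀ - κ * fI k U t₀‖ ≤ (R * (6 / δ ^ 3) + K) * κ ^ (-(3/4) : ℝ) := by
    have sub : uIcc s t₀ ⊆ Icc s S := by
      rw [uIcc_of_le mt.1]; exact Icc_subset_Icc le_rfl mt.2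
    have ob := ode_bound (c := -κ) (x := s) (y := t₀) (v := fun t => fI k Ut t - κ * fI k U t)
      (φ := fI k (nlF U G)) (cfk.mono sub)
      (fun t ht => ((h.duk1 k (subO (sub ht))).sub
        ((h.duk k (subO (sub ht))).const_mul (κ : ℂ))).congr_deriv (by
          rw [kk]; push_cast; ring))
    have i1 : |∫ τ in s..t₀, exp (-κ * (t₀ - τ)) * ‖fI k (nlF U G) τ‖|
        ≤ K * κ ^ (-(3/4) : ℝ) := by
      refine (abs_integral_le_of_sub ms mt ckern kern0 ?_).trans hK
      intro τ hτ
      rw [abs_of_nonneg (by positivity)]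
      rw [uIcc_of_le mt.1] at hτ
      rw [abs_of_nonneg (sub_nonneg.2 hτ.2), neg_mul]
      exact mul_le_mul_of_nonneg_left (fk_le τ ⟨hτ.1, hτ.2.trans mt.2⟩) (exp_pos _).le
    have i2 : exp (-κ * (t₀ - s)) * ‖fI k Ut s - κ * fI k U s‖
        ≤ R * (6 / δ ^ 3) * κ ^ (-(3/4) : ℝ) := by
      refine le_trans (mul_le_mul ?_ ?_ (norm_nonneg _) (exp_pos _).le) (exp_decay hk hδ R0)
      · rw [Real.exp_le_exp]; nlinarith
      · refine (norm_sub_le _ _).trans ?_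
        rw [nκ]
        exact endb s ms S mS (abs_of_pos hℓ)
    calc _ ≤ _ := ob
      _ ≤ _ := add_le_add i2 i1
      _ = _ := by ring
  have hp : ‖fI k Ut t₀ + κ * fI k U t₀‖ ≤ (R * (6 / δ ^ 3) + K) * κ ^ (-(3/4) : ℝ) := by
    have sub : uIcc S t₀ ⊆ Icc s S := by
      rw [uIcc_of_ge mt.2]; exact Icc_subset_Icc mt.1 le_rfl
    have ob := ode_bound (c := κ) (x := S) (y := t₀) (v := fun t => fI k Ut t + κ * fI k U t)
      (φ := fI k (nlF U G)) (cfk.mono sub)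
      (fun t ht => ((h.duk1 k (subO (sub ht))).add
        ((h.duk k (subO (sub ht))).const_mul (κ : ℂ))).congr_deriv (by
          rw [kk]; ring))
    have i1 : |∫ τ in S..t₀, exp (κ * (t₀ - τ)) * ‖fI k (nlF U G) τ‖|
        ≤ K * κ ^ (-(3/4) : ℝ) := by
      refine (abs_integral_le_of_sub mS mt ckern kern0 ?_).trans hK
      intro τ hτ
      rw [abs_of_nonneg (by positivity)]
      rw [uIcc_of_ge mt.2] at hτ
      rw [abs_of_nonpos (sub_nonpos.2 hτ.1), mul_neg, neg_neg]
      exact mul_le_mul_of_nonneg_left (fk_le τ ⟨mt.1.trans hτ.1, hτ.2⟩) (exp_pos _).le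
    have i2 : exp (κ * (t₀ - S)) * ‖fI k Ut S + κ * fI k U S‖
        ≤ R * (6 / δ ^ 3) * κ ^ (-(3/4) : ℝ) := by
      refine le_trans (mul_le_mul ?_ ?_ (norm_nonneg _) (exp_pos _).le) (exp_decay hk hδ R0)
      · rw [Real.exp_le_exp]; nlinarith
      · refine (norm_add_le _ _).trans ?_
        rw [nκ]
        exact endb S mS s ms (by rw [abs_sub_comm]; exact abs_of_pos hℓ)
    calc _ ≤ _ := ob
      _ ≤ _ := add_le_add i2 i1
      _ = _ := by ring
  have e : fI k Ut t₀ = ((1/2 : ℝ) : ℂ) * ((fI k Ut t₀ - κ * fI k U t₀)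
      + (fI k Ut t₀ + κ * fI k U t₀)) := by push_cast; ring
  have e2 : ‖fI k Ut t₀‖ ≤ 1/2 * (‖fI k Ut t₀ - κ * fI k U t₀‖
      + ‖fI k Ut t₀ + κ * fI k U t₀‖) := by
    conv_lhs => rw [e]
    rw [norm_mul, Complex.norm_real, Real.norm_of_nonneg (by norm_num)]
    gcongr
    exact norm_add_le _ _
  linarith

end StripSol

lemma parseval_bound {f : ℝ → ℝ → ℝ} {t C0 C1 : ℝ} (hf : Continuous (f t))
    (h0 : ‖fI 0 f t‖ ≤ C0)
    (h1 : ∀ k : ℤ, 1 ≤ |(k : ℝ)| → ‖fI k f t‖ ≤ C1 * |(k : ℝ)| ^ (-(3/4) : ℝ)) :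
    mI (fun t θ => f t θ ^ 2) t
      ≤ (2 * π)⁻¹ * (C0 ^ 2 + C1 ^ 2 * ∑' k : ℤ, |(k : ℝ)| ^ (-(3/2) : ℝ)) := by
  have hab : (0:ℝ) < 2 * π := by positivity
  set g : ℝ → ℂ := fun θ => (f t θ : ℂ) with hg
  have cg : Continuous g := Complex.continuous_ofReal.comp hf
  have hmem : MemLp g 2 (volume.restrict (Ioc 0 (2 * π))) := by
    obtain ⟨C, hC⟩ := (isCompact_Icc (a := (0:ℝ)) (b := 2 * π)).exists_bound_of_continuousOn
      cg.continuousOn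
    refine MemLp.of_bound cg.aestronglyMeasurable C ?_
    exact (ae_restrict_iff' measurableSet_Ioc).2
      (Eventually.of_forall fun τ hτ => hC τ (Ioc_subset_Icc_self hτ))
  have P := hasSum_sq_fourierCoeffOn hab hmem
  have coe : ∀ k : ℤ, ‖fourierCoeffOn hab g k‖ = (2 * π)⁻¹ * ‖fI k f t‖ := by
    intro k
    rw [fourierCoeffOn_eq_integral, norm_smul, sub_zero, Real.norm_of_nonneg (by positivity),
      one_div]
    congr 2
    unfold fI
    refine intervalIntegral.integral_congr fun θ _ => ?_
    simp only [fourier_coe_apply, smul_eq_mul, hg, ek]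
    congr 2
    have : (π : ℂ) ≠ 0 := by exact_mod_cast pi_ne_zero
    push_cast
    field_simp
  have S1 : Summable (fun k : ℤ => |(k : ℝ)| ^ (-(3/2) : ℝ)) :=
    Real.summable_abs_int_rpow (by norm_num)
  have Hg : HasSum (fun k : ℤ => ((2 * π)⁻¹) ^ 2 * ((if k = 0 then C0 ^ 2 else 0)
      + C1 ^ 2 * |(k : ℝ)| ^ (-(3/2) : ℝ)))
      (((2 * π)⁻¹) ^ 2 * (C0 ^ 2 + C1 ^ 2 * ∑' k : ℤ, |(k : ℝ)| ^ (-(3/2) : ℝ))) :=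
    ((hasSum_ite_eq 0 (C0 ^ 2)).add (S1.hasSum.mul_left _)).mul_left _
  have le := hasSum_le (fun k => ?_) P Hg
  · rw [sub_zero, smul_eq_mul] at le
    have e : ∫ x in (0:ℝ)..(2 * π), ‖g x‖ ^ 2 = mI (fun t θ => f t θ ^ 2) t := by
      unfold mI
      refine intervalIntegral.integral_congr fun θ _ => ?_
      simp only [hg, Complex.norm_real, Real.norm_eq_abs, sq_abs]
    rw [e, sq, mul_assoc] at le
    exact le_of_mul_le_mul_left le (by positivity)
  · rw [coe, mul_pow]
    refine mul_le_mul_of_nonneg_left ?_ (by positivity)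
    by_cases hk : k = 0
    · subst hk
      simp only [if_true]
      have : ‖fI 0 f t‖ ^ 2 ≤ C0 ^ 2 := by gcongr
      have : 0 ≤ C1 ^ 2 * |((0:ℤ) : ℝ)| ^ (-(3/2) : ℝ) := by positivity
      linarith
    · have hk1 : 1 ≤ |(k : ℝ)| := by exact_mod_cast Int.one_le_abs hk
      rw [if_neg hk, zero_add]
      have := h1 k hk1
      calc ‖fI k f t‖ ^ 2 ≤ (C1 * |(k : ℝ)| ^ (-(3/4) : ℝ)) ^ 2 := by gcongr
        _ = C1 ^ 2 * |(k : ℝ)| ^ (-(3/2) : ℝ) := by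
          rw [mul_pow, ← Real.rpow_natCast (|(k : ℝ)| ^ (-(3/4) : ℝ)), ← Real.rpow_mul (by positivity)]
          norm_num

theorem strip_main {A B g c : ℝ} (hAB : A < B) (hg : 0 < g) (hc : 0 ≤ c) :
    ∃ C : ℝ, ∀ U Ut Us Utt Uts Uss G : ℝ → ℝ → ℝ, StripSol A B U Ut Us Utt Uts Uss G →
      (∀ t ∈ Icc (A + (B - A) / 4) (B - (B - A) / 4), ∀ θ, g ≤ G t θ) →
      (∀ θ, MonotoneOn (fun t => exp (c * t) * G t θ) (Icc A (B - (B - A) / 4))) →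
      mI (fun t θ => Ut t θ ^ 2) A ≤ C := by
  set D := B - A with hD
  have hDpos : 0 < D := sub_pos.2 hAB
  set M0 := 1024 * π / (g * D ^ 2) with hM0
  have M00 : 0 ≤ M0 := by positivity
  set N := 8 * M0 / D with hNdef
  have N0 : 0 ≤ N := by positivity
  set s := A + D / 4 with hs
  set S := B - D / 4 with hS
  obtain ⟨K, K0, hK⟩ := good_slice (s := s) (S := S) (t₁ := A + 3 * D / 8) (t₂ := B - 3 * D / 8)
    (N := N) (by linarith) (by linarith) (by linarith) N0
  set C1 := (2 * M0 / (S - s) + M0 * (S - s) + N + M0) * (6 / (D / 8) ^ 3) + K with hC1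
  set Q := (2 * π)⁻¹ * ((4 * M0 / D) ^ 2 + C1 ^ 2 * ∑' k : ℤ, |(k : ℝ)| ^ (-(3/2) : ℝ)) with hQ
  refine ⟨2 * (Q + 2 * K + 4 * π * c ^ 2 + 2 * c * (4 * M0 / D)), ?_⟩
  intro U Ut Us Utt Uts Uss G h hG hmono
  obtain ⟨M, hM, hMM, hUM, hUt⟩ := h.mass_bound hAB hg hG
  have hUM0 : ∀ t ∈ Icc A B, mI U t ≤ M0 := fun t ht => (hUM t ht).trans hMM
  have hUt0 : ∀ t ∈ Icc s S, |mI Ut t| ≤ 4 * M0 / D := fun t ht => by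
    refine (hUt t ht).trans ?_
    gcongr
  have hsS : s ≤ S := by linarith
  have hN : ∫ t in s..S, mI (nlF U G) t ≤ N := by
    rw [h.int_f0 (by linarith) hsS (by linarith)]
    have h1 := abs_le.1 (hUt0 s ⟨le_rfl, hsS⟩)
    have h2 := abs_le.1 (hUt0 S ⟨hsS, le_rfl⟩)
    have : N = 4 * M0 / D + 4 * M0 / D := by rw [hNdef]; ring
    linarith [h1.2, h2.1]
  have subI : Icc s S ⊆ Icc A B := Icc_subset_Icc (by linarith) (by linarith)
  obtain ⟨t₀, ht₀, hfK, hker⟩ := hK (mI (nlF U G)) ((mI_cont hAB.le h.cF).mono subI)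
    (fun t ht => mI_nonneg (h.F0 (subI ht))) hN
  have mt : t₀ ∈ Icc s S := ⟨by linarith [ht₀.1], by linarith [ht₀.2]⟩
  have hPars : mI (fun t θ => Ut t θ ^ 2) t₀ ≤ Q := by
    refine parseval_bound (strip_slice h.cUt (subI mt)) ?_ ?_
    · have : fI 0 Ut t₀ = ((mI Ut t₀ : ℝ) : ℂ) := by
        unfold fI mI
        rw [← intervalIntegral.integral_ofReal]
        refine intervalIntegral.integral_congr fun θ _ => ?_
        simp [ek]
      rw [this, Complex.norm_real, Real.norm_eq_abs]
      exact hUt0 t₀ mt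
    · intro k hk
      exact h.mode_bound (by linarith) (by linarith) (by positivity) (by linarith [ht₀.1])
        (by linarith [ht₀.2]) M00 hUM0 hN k hk (hker _ hk)
  have E := h.end_estimate (c := c) (t₀ := t₀) (by linarith [mt.1]) (by linarith [mt.2])
    (fun θ => (hmono θ).mono (Icc_subset_Icc le_rfl mt.2))
  have cA : Continuous (Ut A) := strip_slice h.cUt ⟨le_rfl, hAB.le⟩
  have Y : 2 * c * mI Ut A ≤ mI (fun t θ => Ut t θ ^ 2) A / 2 + 4 * π * c ^ 2 := by
    have : ∫ θ in (0:ℝ)..(2 * π), (2 * c) * Ut A θ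
        ≤ ∫ θ in (0:ℝ)..(2 * π), ((1/2) * Ut A θ ^ 2 + 2 * c ^ 2) := by
      refine intervalIntegral.integral_mono_on (by positivity)
        (Continuous.intervalIntegrable (by fun_prop) _ _)
        (Continuous.intervalIntegrable (by fun_prop) _ _) (fun θ _ => ?_)
      nlinarith [sq_nonneg (Ut A θ - 2 * c)]
    rw [intervalIntegral.integral_add (Continuous.intervalIntegrable (by fun_prop) _ _) (by simp),
      intervalIntegral.integral_const_mul, intervalIntegral.integral_const_mul,
      intervalIntegral.integral_const, smul_eq_mul] at this
    unfold mI
    linarith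
  have Z := (abs_le.1 (hUt0 t₀ mt)).1
  have Z2 : 2 * c * (-(4 * M0 / D)) ≤ 2 * c * mI Ut t₀ :=
    mul_le_mul_of_nonneg_left Z (by positivity)
  linarith

/-! ### From the annulus to the strip -/

lemma circlePt_eq (r θ : ℝ) : circlePt r θ =
    (r * cos θ) • (EuclideanSpace.single 0 1 : E2) + (r * sin θ) • EuclideanSpace.single 1 1 := by
  ext i
  fin_cases i <;> simp [circlePt]

lemma circlePt_smul (r θ : ℝ) : circlePt r θ = r • circlePt 1 θ := by
  rw [circlePt_eq, circlePt_eq, smul_add, smul_smul, smul_smul, one_mul, one_mul]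

lemma norm_circlePt {r : ℝ} (hr : 0 ≤ r) (θ : ℝ) : ‖circlePt r θ‖ = r := by
  rw [EuclideanSpace.norm_eq, Real.sqrt_eq_iff_mul_self_eq (by positivity) hr]
  simp [circlePt, Fin.sum_univ_two]
  nlinarith [Real.sin_sq_add_cos_sq θ]

/-- point of the annulus in logarithmic polar coordinates -/
def Xp (t θ : ℝ) : E2 := circlePt (exp t) θ

/-- rotated point -/
def Yp (t θ : ℝ) : E2 := circlePt (exp t) (θ + π / 2)

lemma norm_Xp (t θ : ℝ) : ‖Xp t θ‖ = exp t := norm_circlePt (exp_pos t).le θ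

lemma Xp_cont : Continuous (fun p : ℝ × ℝ => Xp p.1 p.2) := by
  simp only [Xp, circlePt_eq]; fun_prop

lemma Yp_cont : Continuous (fun p : ℝ × ℝ => Yp p.1 p.2) := by
  simp only [Yp, circlePt_eq]; fun_prop

lemma Xp_dt (t θ : ℝ) : HasDerivAt (fun t => Xp t θ) (Xp t θ) t := by
  simp only [Xp, circlePt_eq]
  exact (((Real.hasDerivAt_exp t).mul_const _).smul_const _).add
    (((Real.hasDerivAt_exp t).mul_const _).smul_const _)

lemma Yp_dt (t θ : ℝ) : HasDerivAt (fun t => Yp t θ) (Yp t θ) t := Xp_dt t (θ + π / 2)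

lemma Xp_ds (t θ : ℝ) : HasDerivAt (fun θ => Xp t θ) (Yp t θ) θ := by
  simp only [Xp, Yp, circlePt_eq, Real.cos_add_pi_div_two, Real.sin_add_pi_div_two]
  exact (((Real.hasDerivAt_cos θ).const_mul _).smul_const _).add
    (((Real.hasDerivAt_sin θ).const_mul _).smul_const _)

lemma Yp_ds (t θ : ℝ) : HasDerivAt (fun θ => Yp t θ) (- Xp t θ) θ := by
  simp only [Xp, Yp, circlePt_eq, Real.cos_add_pi_div_two, Real.sin_add_pi_div_two]
  exact ((((Real.hasDerivAt_sin θ).neg.const_mul _).smul_const _).add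
    (((Real.hasDerivAt_cos θ).const_mul _).smul_const _)).congr_deriv (by module)

lemma Xp_per (t : ℝ) : Xp t (2 * π) = Xp t 0 := by simp [Xp, circlePt]

lemma Yp_per (t : ℝ) : Yp t (2 * π) = Yp t 0 := by
  simp only [Yp, circlePt_eq, Real.cos_add_pi_div_two, Real.sin_add_pi_div_two]
  simp

lemma Omega_open : IsOpen Omega := by
  have : Omega = (fun x : E2 => ‖x‖) ⁻¹' Ioo (1/2) 1 := rfl
  rw [this]
  exact isOpen_Ioo.preimage continuous_norm

lemma closure_Omega : closure Omega = {x : E2 | 1/2 ≤ ‖x‖ ∧ ‖x‖ ≤ 1} := by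
  apply Subset.antisymm
  · refine closure_minimal (fun x hx => ⟨hx.1.le, hx.2.le⟩) ?_
    exact isClosed_Icc.preimage continuous_norm
  · intro x hx
    have hx0 : 0 < ‖x‖ := by linarith [hx.1]
    have hc : Continuous (fun t : ℝ => t • x) := by fun_prop
    have h1 := image_closure_subset_closure_image (s := Ioo (1/2/‖x‖) (1/‖x‖)) hc
    have hlt : 1/2/‖x‖ < 1/‖x‖ := by gcongr; norm_num
    rw [closure_Ioo hlt.ne] at h1
    have h2 : x ∈ closure ((fun t : ℝ => t • x) '' Ioo (1/2/‖x‖) (1/‖x‖)) := by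
      refine h1 ⟨1, ⟨?_, ?_⟩, one_smul _ _⟩
      · rw [div_le_one hx0]; exact hx.1
      · rw [le_div_iff₀ hx0, one_mul]; exact hx.2
    refine closure_mono ?_ h2
    rintro _ ⟨t, ht, rfl⟩
    have ht0 : 0 < t := lt_trans (by positivity) ht.1
    show 1/2 < ‖t • x‖ ∧ ‖t • x‖ < 1
    rw [norm_smul, Real.norm_of_nonneg ht0.le]
    exact ⟨(div_lt_iff₀ hx0).1 ht.1, (lt_div_iff₀ hx0).1 ht.2⟩

lemma isCompact_clOmega : IsCompact (closure Omega) := by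
  refine Metric.isCompact_of_isClosed_isBounded isClosed_closure ?_
  refine (Metric.isBounded_closedBall (x := (0 : E2)) (r := 1)).subset ?_
  intro x hx
  rw [closure_Omega] at hx
  simpa using hx.2

lemma mem_frontier_Omega {x : E2} (hx : x ∈ closure Omega) (h : ‖x‖ = 1/2 ∨ ‖x‖ = 1) :
    x ∈ frontier Omega := by
  rw [frontier, Omega_open.interior_eq]
  refine ⟨hx, fun hO => ?_⟩
  rcases h with h | h
  · have := hO.1; linarith
  · have := hO.2; linarith

lemma uniqueDiff_clOmega : UniqueDiffOn ℝ (closure Omega) := by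
  intro x hx
  have hx' := hx
  rw [closure_Omega] at hx'
  have hx0 : 0 < ‖x‖ := by linarith [hx'.1]
  set y : E2 := (3 / 4 / ‖x‖) • x with hy
  have ny : ‖y‖ = 3/4 := by
    rw [hy, norm_smul, Real.norm_of_nonneg (by positivity)]
    field_simp
  have sub : Metric.closedBall y (1/4) ⊆ closure Omega := by
    intro z hz
    rw [mem_closedBall_iff_norm] at hz
    rw [closure_Omega]
    have h1 := norm_sub_norm_le z y
    have h2 := norm_sub_norm_le y z
    rw [norm_sub_rev] at h2
    constructor <;> linarith
  have mem : x ∈ Metric.closedBall y (1/4) := by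
    rw [mem_closedBall_iff_norm]
    have : x - y = (1 - 3 / 4 / ‖x‖) • x := by rw [hy, sub_smul, one_smul]
    rw [this, norm_smul, Real.norm_eq_abs, ← abs_of_pos hx0, ← abs_mul, abs_of_pos hx0, sub_mul,
      one_mul, div_mul_cancel₀ _ hx0.ne']
    rw [abs_le]; constructor <;> linarith [hx'.1, hx'.2]
  refine (uniqueDiffOn_convex (convex_closedBall y (1/4)) ?_ x mem).mono sub
  rw [interior_closedBall _ (by norm_num)]
  exact ⟨y, Metric.mem_ball_self (by norm_num)⟩

lemma exp_logA : exp (-Real.log 2) = 1/2 := by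
  rw [Real.exp_neg, Real.exp_log (by norm_num)]; norm_num

lemma Xp_mem_cl {t : ℝ} (ht : t ∈ Icc (-Real.log 2) 0) (θ : ℝ) : Xp t θ ∈ closure Omega := by
  rw [closure_Omega]
  show 1/2 ≤ ‖Xp t θ‖ ∧ ‖Xp t θ‖ ≤ 1
  rw [norm_Xp, ← exp_logA]
  exact ⟨Real.exp_le_exp.2 ht.1, Real.exp_le_one_iff.2 ht.2⟩

lemma Xp_mem {t : ℝ} (ht : t ∈ Ioo (-Real.log 2) 0) (θ : ℝ) : Xp t θ ∈ Omega := by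
  show 1/2 < ‖Xp t θ‖ ∧ ‖Xp t θ‖ < 1
  rw [norm_Xp, ← exp_logA]
  exact ⟨Real.exp_lt_exp.2 ht.1, Real.exp_lt_one_iff.2 ht.2⟩

/-- second derivative test (necessary condition) -/
lemma snd_deriv_nonneg {f f' : ℝ → ℝ} {x c : ℝ} (h1 : ∀ᶠ y in 𝓝 x, HasDerivAt f (f' y) y)
    (h2 : HasDerivAt f' c x) (hm : IsLocalMin f x) : 0 ≤ c := by
  by_contra hc
  push Not at hc
  have e1 : deriv f =ᶠ[𝓝 x] f' := h1.mono fun y hy => hy.deriv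
  have d2 : deriv (deriv f) x = c := by rw [e1.deriv_eq]; exact h2.deriv
  have d1 : deriv f x = 0 := hm.deriv_eq_zero
  have hM : IsLocalMax f x :=
    isLocalMax_of_deriv_deriv_neg (by rw [d2]; exact hc) d1 h1.self_of_nhds.continuousAt
  have ec : f =ᶠ[𝓝 x] fun _ => f x := by
    filter_upwards [hm, hM] with y a b using le_antisymm b a
  have e2 : deriv f =ᶠ[𝓝 x] fun _ => 0 := by
    filter_upwards [ec.eventually_nhds] with y hy
    rw [Filter.EventuallyEq.deriv_eq hy]; simp
  rw [e2.deriv_eq] at d2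
  simp at d2
  linarith

section sol
variable {u : E2 → ℝ}

lemma sol_fderiv (hu : ContDiffOn ℝ 2 u (closure Omega)) {x : E2} (hx : x ∈ Omega) :
    ContDiffAt ℝ 2 u x ∧ HasFDerivAt u (fderivWithin ℝ u (closure Omega) x) x ∧
    HasFDerivAt (fderivWithin ℝ u (closure Omega)) (fderiv ℝ (fderiv ℝ u) x) x := by
  have hn : ∀ y ∈ Omega, closure Omega ∈ 𝓝 y := fun y hy =>
    mem_of_superset (Omega_open.mem_nhds hy) subset_closure
  have c2 : ContDiffAt ℝ 2 u x := hu.contDiffAt (hn x hx)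
  have e : fderivWithin ℝ u (closure Omega) =ᶠ[𝓝 x] fderiv ℝ u := by
    filter_upwards [Omega_open.mem_nhds hx] with y hy
    exact fderivWithin_of_mem_nhds (hn y hy)
  refine ⟨c2, ?_, ?_⟩
  · rw [e.eq_of_nhds]
    exact (c2.differentiableAt (by norm_num)).hasFDerivAt
  · refine HasFDerivAt.congr_of_eventuallyEq ?_ e
    have : ContDiffAt ℝ 1 (fderiv ℝ u) x := c2.fderiv_right (by norm_num)
    exact (this.differentiableAt (by norm_num)).hasFDerivAt

lemma lap_eq (x : E2) : lap u x = ∑ i : Fin 2, fderiv ℝ (fderiv ℝ u) x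
    (EuclideanSpace.single i 1) (EuclideanSpace.single i 1) := by
  unfold lap
  refine Finset.sum_congr rfl fun i _ => ?_
  rw [iteratedFDeriv_two_apply]
  simp

lemma sol_nonneg (hu : ContDiffOn ℝ 2 u (closure Omega)) (h0 : ∀ x ∈ frontier Omega, u x = 0)
    (hl : ∀ x ∈ Omega, lap u x < 0) : ∀ x ∈ closure Omega, 0 ≤ u x := by
  intro x hx
  obtain ⟨y, hy, hmin⟩ := isCompact_clOmega.exists_isMinOn ⟨x, hx⟩ hu.continuousOn
  refine le_trans ?_ (hmin hx)
  by_cases hyO : y ∈ Omega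
  · exfalso
    have hlm : IsLocalMin u y := by
      filter_upwards [Omega_open.mem_nhds hyO] with z hz using hmin (subset_closure hz)
    have key : ∀ v : E2, 0 ≤ fderiv ℝ (fderiv ℝ u) y v v := by
      intro v
      have hline : ∀ τ : ℝ, HasDerivAt (fun τ : ℝ => y + τ • v) v τ := fun τ => by
        simpa using ((hasDerivAt_id τ).smul_const v).const_add y
      have hcont : ContinuousAt (fun τ : ℝ => y + τ • v) 0 := (hline 0).continuousAt
      have ev : ∀ᶠ τ in 𝓝 (0:ℝ), y + τ • v ∈ Omega :=
        hcont.eventually_mem (by simpa using Omega_open.mem_nhds hyO)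
      refine snd_deriv_nonneg (f := fun τ : ℝ => u (y + τ • v))
        (f' := fun τ : ℝ => fderivWithin ℝ u (closure Omega) (y + τ • v) v) (x := 0) ?_ ?_ ?_
      · filter_upwards [ev] with τ hτ
        exact (sol_fderiv hu hτ).2.1.comp_hasDerivAt τ (hline τ)
      · have h3 := (sol_fderiv hu hyO).2.2
        have h4 : HasDerivAt (fun τ : ℝ => fderivWithin ℝ u (closure Omega) (y + τ • v))
            (fderiv ℝ (fderiv ℝ u) y v) 0 := by
          refine HasFDerivAt.comp_hasDerivAt_of_eq (0:ℝ) h3 (hline 0) (by simp)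
        simpa using h4.clm_apply (hasDerivAt_const (0:ℝ) v)
      · have : IsLocalMin (u ∘ fun τ : ℝ => y + τ • v) 0 := by
          refine IsLocalMin.comp_continuous ?_ hcont
          simpa using hlm
        exact this
    have := hl y hyO
    rw [lap_eq, Fin.sum_univ_two] at this
    linarith [key (EuclideanSpace.single 0 1), key (EuclideanSpace.single 1 1)]
  · refine (h0 y ?_).ge
    rw [frontier, Omega_open.interior_eq]
    exact ⟨hy, hyO⟩

lemma lap_polar (L : E2 →L[ℝ] E2 →L[ℝ] ℝ) (t θ : ℝ)
    (hsymm : ∀ v w, L v w = L w v) :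
    L (Xp t θ) (Xp t θ) + L (Yp t θ) (Yp t θ) = exp t ^ 2 * ∑ i : Fin 2,
      L (EuclideanSpace.single i 1) (EuclideanSpace.single i 1) := by
  simp only [Xp, Yp, circlePt_eq, Real.cos_add_pi_div_two, Real.sin_add_pi_div_two, map_add,
    map_smul, add_apply, smul_apply, smul_eq_mul,
    Fin.sum_univ_two]
  rw [hsymm (EuclideanSpace.single 1 1) (EuclideanSpace.single 0 1)]
  have h := Real.sin_sq_add_cos_sq θ
  linear_combination (exp t ^ 2 * (L (EuclideanSpace.single 0 1) (EuclideanSpace.single 0 1)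
    + L (EuclideanSpace.single 1 1) (EuclideanSpace.single 1 1))) * h

set_option maxHeartbeats 1000000 in
theorem sol_strip {β : ℝ} {x₀ : E2} {V : E2 → ℝ} (hβ : 0 ≤ β)
    (hV : ContinuousOn V (closure Omega)) (hV0 : ∀ x ∈ closure Omega, 0 < V x)
    (hx₀ : ‖x₀‖ = 1/2)
    (h : IsSolPbeta β x₀ V u) :
    StripSol (-Real.log 2) 0 (fun t θ => u (Xp t θ))
      (fun t θ => fderivWithin ℝ u (closure Omega) (Xp t θ) (Xp t θ))
      (fun t θ => fderivWithin ℝ u (closure Omega) (Xp t θ) (Yp t θ))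
      (fun t θ => fderiv ℝ (fderiv ℝ u) (Xp t θ) (Xp t θ) (Xp t θ)
        + fderivWithin ℝ u (closure Omega) (Xp t θ) (Xp t θ))
      (fun t θ => fderiv ℝ (fderiv ℝ u) (Xp t θ) (Yp t θ) (Xp t θ)
        + fderivWithin ℝ u (closure Omega) (Xp t θ) (Yp t θ))
      (fun t θ => fderiv ℝ (fderiv ℝ u) (Xp t θ) (Yp t θ) (Yp t θ)
        - fderivWithin ℝ u (closure Omega) (Xp t θ) (Xp t θ))
      (fun t θ => exp t ^ 2 * (‖Xp t θ - x₀‖ ^ (2 * β) * V (Xp t θ))) := by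
  obtain ⟨hu, hfr, heq⟩ := h
  set du := fderivWithin ℝ u (closure Omega) with hdu
  have cdu : ContinuousOn du (closure Omega) :=
    hu.continuousOn_fderivWithin uniqueDiff_clOmega (by norm_num)
  have cd2 : ContinuousOn (fderiv ℝ (fderiv ℝ u)) Omega := by
    have h1 : ContDiffOn ℝ 1 (fderiv ℝ u) Omega :=
      (hu.mono subset_closure).fderiv_of_isOpen Omega_open (by norm_num)
    exact h1.continuousOn_fderiv_of_isOpen Omega_open (by norm_num)
  have mapI : MapsTo (fun p : ℝ × ℝ => Xp p.1 p.2) (Icc (-Real.log 2) 0 ×ˢ univ)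
      (closure Omega) := fun p hp => Xp_mem_cl hp.1 p.2
  have mapO : MapsTo (fun p : ℝ × ℝ => Xp p.1 p.2) (Ioo (-Real.log 2) 0 ×ˢ univ)
      Omega := fun p hp => Xp_mem hp.1 p.2
  have cduX : ContinuousOn (fun p : ℝ × ℝ => du (Xp p.1 p.2)) (Icc (-Real.log 2) 0 ×ˢ univ) :=
    cdu.comp Xp_cont.continuousOn mapI
  have cd2X : ContinuousOn (fun p : ℝ × ℝ => fderiv ℝ (fderiv ℝ u) (Xp p.1 p.2))
      (Ioo (-Real.log 2) 0 ×ˢ univ) := cd2.comp Xp_cont.continuousOn mapO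
  have cX := fun s : Set (ℝ × ℝ) => Xp_cont.continuousOn (s := s)
  have cY := fun s : Set (ℝ × ℝ) => Yp_cont.continuousOn (s := s)
  have symm : ∀ x ∈ Omega, ∀ v w, fderiv ℝ (fderiv ℝ u) x v w = fderiv ℝ (fderiv ℝ u) x w v := by
    intro x hx v w
    exact ((sol_fderiv hu hx).1.isSymmSndFDerivAt (by simp)).eq v w
  have lneg : ∀ x ∈ Omega, lap u x < 0 := by
    intro x hx
    have e := heq x hx
    have hne : 0 < ‖x - x₀‖ := by
      rw [norm_pos_iff, sub_ne_zero]
      rintro rfl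
      have := hx.1
      linarith
    have := hV0 x (subset_closure hx)
    have : 0 < ‖x - x₀‖ ^ (2 * β) * V x * exp (u x) := by positivity
    linarith
  have D1 : ∀ t ∈ Ioo (-Real.log 2) 0, ∀ θ, HasFDerivAt u (du (Xp t θ)) (Xp t θ) :=
    fun t ht θ => (sol_fderiv hu (Xp_mem ht θ)).2.1
  have D2 : ∀ t ∈ Ioo (-Real.log 2) 0, ∀ θ,
      HasFDerivAt du (fderiv ℝ (fderiv ℝ u) (Xp t θ)) (Xp t θ) :=
    fun t ht θ => (sol_fderiv hu (Xp_mem ht θ)).2.2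
  have zU : ∀ t : ℝ, t ∈ Icc (-Real.log 2) 0 → (exp t = 1/2 ∨ exp t = 1) → ∀ θ, u (Xp t θ) = 0 :=
    fun t ht h θ => hfr _ (mem_frontier_Omega (Xp_mem_cl ht θ) (by rwa [norm_Xp]))
  have zUs : ∀ t : ℝ, t ∈ Icc (-Real.log 2) 0 → (exp t = 1/2 ∨ exp t = 1) →
      ∀ θ, du (Xp t θ) (Yp t θ) = 0 := by
    intro t ht h θ
    have h1 : HasFDerivWithinAt u (du (Xp t θ)) (closure Omega) (Xp t θ) :=
      (hu.differentiableOn (by norm_num) _ (Xp_mem_cl ht θ)).hasFDerivWithinAt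
    have h2 := h1.comp_hasDerivAt θ (Xp_ds t θ) (Eventually.of_forall fun θ' => Xp_mem_cl ht θ')
    have h3 : (u ∘ fun θ => Xp t θ) = fun _ => 0 := by
      funext θ'; exact zU t ht h θ'
    rw [h3] at h2
    exact h2.unique (hasDerivAt_const θ 0)
  have l2 : (0:ℝ) ≤ Real.log 2 := Real.log_nonneg (by norm_num)
  have mA : -Real.log 2 ∈ Icc (-Real.log 2) 0 := ⟨le_rfl, by linarith⟩
  have mB : (0:ℝ) ∈ Icc (-Real.log 2) 0 := ⟨by linarith, le_rfl⟩
  constructor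
  · exact hu.continuousOn.comp Xp_cont.continuousOn mapI
  · exact cduX.clm_apply (cX _)
  · exact cduX.clm_apply (cY _)
  · have c1 : Continuous (fun p : ℝ × ℝ => ‖Xp p.1 p.2 - x₀‖ ^ (2 * β)) :=
      (Xp_cont.sub continuous_const).norm.rpow_const (fun _ => Or.inr (by positivity))
    have c2 : Continuous (fun p : ℝ × ℝ => exp p.1 ^ 2) := by fun_prop
    exact c2.continuousOn.mul (c1.continuousOn.mul (hV.comp Xp_cont.continuousOn mapI))
  · exact ((cd2X.clm_apply (cX _)).clm_apply (cX _)).add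
      ((cduX.mono Ioo_prod_sub).clm_apply (cX _))
  · exact ((cd2X.clm_apply (cY _)).clm_apply (cX _)).add
      ((cduX.mono Ioo_prod_sub).clm_apply (cY _))
  · exact ((cd2X.clm_apply (cY _)).clm_apply (cY _)).sub
      ((cduX.mono Ioo_prod_sub).clm_apply (cX _))
  · intro t ht θ
    exact (D1 t ht θ).comp_hasDerivAt t (Xp_dt t θ)
  · intro t ht θ
    exact (D1 t ht θ).comp_hasDerivAt θ (Xp_ds t θ)
  · intro t ht θ
    exact ((D2 t ht θ).comp_hasDerivAt t (Xp_dt t θ)).clm_apply (Xp_dt t θ)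
  · intro t ht θ
    exact ((D2 t ht θ).comp_hasDerivAt θ (Xp_ds t θ)).clm_apply (Xp_ds t θ)
  · intro t ht θ
    refine (((D2 t ht θ).comp_hasDerivAt t (Xp_dt t θ)).clm_apply (Yp_dt t θ)).congr_deriv ?_
    rw [symm _ (Xp_mem ht θ)]
  · intro t ht θ
    refine (((D2 t ht θ).comp_hasDerivAt θ (Xp_ds t θ)).clm_apply (Yp_ds t θ)).congr_deriv ?_
    rw [map_neg, ← sub_eq_add_neg]; rfl
  · intro t _; simp only [Xp_per]
  · intro t _; simp only [Xp_per]
  · intro t _; simp only [Xp_per, Yp_per]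
  · intro t ht θ
    have e := heq _ (Xp_mem ht θ)
    have e2 := lap_polar (fderiv ℝ (fderiv ℝ u) (Xp t θ)) t θ (symm _ (Xp_mem ht θ))
    rw [← lap_eq] at e2
    linear_combination e2 - exp t ^ 2 * e
  · exact zU _ mA (Or.inl exp_logA)
  · exact zU _ mB (Or.inr Real.exp_zero)
  · exact zUs _ mA (Or.inl exp_logA)
  · exact zUs _ mB (Or.inr Real.exp_zero)
  · intro t ht θ
    exact sol_nonneg hu hfr lneg _ (Xp_mem_cl ht θ)
  · intro t ht θ
    have := hV0 _ (Xp_mem_cl ht θ)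
    positivity

end sol

/-! ### Monotonicity of the weight -/

lemma Xp_sub_norm {t t' : ℝ} (h : t ≤ t') (h0 : t' ≤ 0) (θ : ℝ) :
    ‖Xp t' θ - Xp t θ‖ ≤ t' - t := by
  have e : Xp t' θ - Xp t θ = (exp t' - exp t) • circlePt 1 θ := by
    rw [Xp, Xp, circlePt_smul (exp t'), circlePt_smul (exp t), sub_smul]
  have hle : exp t ≤ exp t' := Real.exp_le_exp.2 h
  rw [e, norm_smul, norm_circlePt zero_le_one, mul_one, Real.norm_of_nonneg (by linarith)]
  have h1 : t - t' + 1 ≤ exp (t - t') := Real.add_one_le_exp _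
  have h2 : exp t = exp t' * exp (t - t') := by rw [← Real.exp_add]; congr 1; ring
  have h3 : exp t' ≤ 1 := Real.exp_le_one_iff.2 h0
  have h4 := exp_pos t'
  rw [h2]
  nlinarith

lemma Xp_dist_mono {x₀ : E2} (hx₀ : ‖x₀‖ = 1/2) {t t' : ℝ} (ht : -Real.log 2 ≤ t) (h : t ≤ t')
    (θ : ℝ) : ‖Xp t θ - x₀‖ ≤ ‖Xp t' θ - x₀‖ := by
  refine le_of_sq_le_sq ?_ (norm_nonneg _)
  have hr : 1/2 ≤ exp t := by rw [← exp_logA]; exact Real.exp_le_exp.2 ht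
  have hle : exp t ≤ exp t' := Real.exp_le_exp.2 h
  have hp : ⟪circlePt 1 θ, x₀⟫ ≤ 1/2 := by
    have := real_inner_le_norm (circlePt 1 θ) x₀
    rw [norm_circlePt zero_le_one, hx₀] at this
    linarith
  rw [norm_sub_sq_real, norm_sub_sq_real, norm_Xp, norm_Xp, Xp, Xp, circlePt_smul (exp t),
    circlePt_smul (exp t'), real_inner_smul_left, real_inner_smul_left]
  nlinarith

lemma V_ratio {V : E2 → ℝ} {a L : ℝ} (ha : 0 < a) (hL : 0 ≤ L)
    (hlip : LipschitzOnWith (Real.toNNReal L) V (closure Omega))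
    (hV : ∀ x ∈ closure Omega, a ≤ V x) {x y : E2} {d : ℝ} (hx : x ∈ closure Omega)
    (hy : y ∈ closure Omega) (hd : ‖x - y‖ ≤ d) : V x ≤ exp (L / a * d) * V y := by
  have h1 := hlip.dist_le_mul x hx y hy
  rw [Real.coe_toNNReal _ hL, Real.dist_eq, dist_eq_norm] at h1
  have h2 := (abs_le.1 h1).2
  have d0 : 0 ≤ d := (norm_nonneg _).trans hd
  have h3 : L * ‖x - y‖ ≤ L * d := mul_le_mul_of_nonneg_left hd hL
  have h4 : L / a * d + 1 ≤ exp (L / a * d) := Real.add_one_le_exp _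
  have h5 := hV y hy
  have h6 : L * d ≤ L / a * d * V y := by
    have : L * d = L / a * d * a := by field_simp
    rw [this]
    exact mul_le_mul_of_nonneg_left h5 (by positivity)
  have h7 : (L / a * d + 1) * V y ≤ exp (L / a * d) * V y :=
    mul_le_mul_of_nonneg_right h4 (by linarith)
  linarith

lemma G_mono_in {β a : ℝ} {x₀ : E2} {V : E2 → ℝ} (hβ : 0 ≤ β) (ha : 0 < a) (hx₀ : ‖x₀‖ = 1/2)
    {L : ℝ} (hL : 0 ≤ L) (hlip : LipschitzOnWith (Real.toNNReal L) V (closure Omega))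
    (hV : ∀ x ∈ closure Omega, a ≤ V x) (θ : ℝ) :
    MonotoneOn (fun t => exp (L / a * t) * (exp t ^ 2 * (‖Xp t θ - x₀‖ ^ (2 * β) * V (Xp t θ))))
      (Icc (-Real.log 2) 0) := by
  intro t ht t' ht' htt
  simp only
  have v := V_ratio (d := t' - t) ha hL hlip hV (Xp_mem_cl ht θ) (Xp_mem_cl ht' θ) (by
    rw [norm_sub_rev]; exact Xp_sub_norm htt ht'.2 θ)
  have v1 := hV _ (Xp_mem_cl ht θ)
  have v' := hV _ (Xp_mem_cl ht' θ)
  have w : exp (L / a * t) * V (Xp t θ) ≤ exp (L / a * t') * V (Xp t' θ) := by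
    calc exp (L / a * t) * V (Xp t θ)
        ≤ exp (L / a * t) * (exp (L / a * (t' - t)) * V (Xp t' θ)) := by gcongr
      _ = exp (L / a * t') * V (Xp t' θ) := by
        rw [← mul_assoc, ← Real.exp_add]; congr 2; ring
  have e1 : exp t ≤ exp t' := Real.exp_le_exp.2 htt
  have n : ‖Xp t θ - x₀‖ ^ (2 * β) ≤ ‖Xp t' θ - x₀‖ ^ (2 * β) :=
    Real.rpow_le_rpow (norm_nonneg _) (Xp_dist_mono hx₀ ht.1 htt θ) (by positivity)
  calc _ = exp t ^ 2 * ‖Xp t θ - x₀‖ ^ (2 * β) * (exp (L / a * t) * V (Xp t θ)) := by ring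
    _ ≤ exp t' ^ 2 * ‖Xp t' θ - x₀‖ ^ (2 * β) * (exp (L / a * t') * V (Xp t' θ)) := by
        have : 0 ≤ V (Xp t θ) := by linarith
        gcongr
    _ = _ := by ring

lemma dist_low {x₀ : E2} (hx₀ : ‖x₀‖ = 1/2) {s t : ℝ} (h : s ≤ t) (θ : ℝ) :
    exp s - 1/2 ≤ ‖Xp t θ - x₀‖ := by
  have := norm_sub_norm_le (Xp t θ) x₀
  rw [norm_Xp, hx₀] at this
  have := Real.exp_le_exp.2 h
  linarith

lemma G_ratio_out {β a : ℝ} {x₀ : E2} {V : E2 → ℝ} (hβ : 0 ≤ β) (ha : 0 < a) (hx₀ : ‖x₀‖ = 1/2)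
    {L : ℝ} (hL : 0 ≤ L) (hlip : LipschitzOnWith (Real.toNNReal L) V (closure Omega))
    (hV : ∀ x ∈ closure Omega, a ≤ V x) (θ : ℝ) {s t t' : ℝ} (hs : -Real.log 2 < s)
    (hst : s ≤ t) (htt : t ≤ t') (ht' : t' ≤ 0) :
    exp t' ^ 2 * (‖Xp t' θ - x₀‖ ^ (2 * β) * V (Xp t' θ))
      ≤ exp ((2 + L / a + 2 * β / (exp s - 1/2)) * (t' - t)) *
        (exp t ^ 2 * (‖Xp t θ - x₀‖ ^ (2 * β) * V (Xp t θ))) := by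
  set δ := exp s - 1/2 with hδ
  have δ0 : 0 < δ := by
    have : exp (-Real.log 2) < exp s := Real.exp_lt_exp.2 hs
    rw [exp_logA] at this
    linarith
  have mt : t ∈ Icc (-Real.log 2) 0 := ⟨by linarith, by linarith⟩
  have mt' : t' ∈ Icc (-Real.log 2) 0 := ⟨by linarith, by linarith⟩
  have v := V_ratio (d := t' - t) ha hL hlip hV (Xp_mem_cl mt' θ) (Xp_mem_cl mt θ)
    (Xp_sub_norm htt ht' θ)
  have v1 := hV _ (Xp_mem_cl mt θ)
  have v' := hV _ (Xp_mem_cl mt' θ)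
  have n1 : δ ≤ ‖Xp t θ - x₀‖ := dist_low hx₀ hst θ
  have n2 : ‖Xp t' θ - x₀‖ ≤ ‖Xp t θ - x₀‖ * exp ((t' - t) / δ) := by
    have h1 : ‖Xp t' θ - x₀‖ ≤ ‖Xp t' θ - Xp t θ‖ + ‖Xp t θ - x₀‖ := norm_sub_le_norm_sub_add_norm_sub _ _ _
    have h2 := Xp_sub_norm htt ht' θ
    have h3 : (t' - t) / δ + 1 ≤ exp ((t' - t) / δ) := Real.add_one_le_exp _
    have h4 : t' - t ≤ ‖Xp t θ - x₀‖ * ((t' - t) / δ) := by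
      have : t' - t = δ * ((t' - t) / δ) := by field_simp
      have h5 : 0 ≤ (t' - t) / δ := div_nonneg (by linarith) δ0.le
      nlinarith
    have h6 := mul_le_mul_of_nonneg_left h3 (norm_nonneg (Xp t θ - x₀))
    linarith
  have n3 : ‖Xp t' θ - x₀‖ ^ (2 * β) ≤ ‖Xp t θ - x₀‖ ^ (2 * β) * exp ((t' - t) / δ * (2 * β)) := by
    rw [Real.exp_mul, ← Real.mul_rpow (norm_nonneg _) (exp_pos _).le]
    exact Real.rpow_le_rpow (norm_nonneg _) n2 (by positivity)
  have e1 : exp t' ^ 2 = exp (2 * (t' - t)) * exp t ^ 2 := by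
    rw [← Real.exp_nat_mul, ← Real.exp_nat_mul, ← Real.exp_add]; congr 1; push_cast; ring
  have e2 : exp ((2 + L / a + 2 * β / δ) * (t' - t))
      = exp (2 * (t' - t)) * exp ((t' - t) / δ * (2 * β)) * exp (L / a * (t' - t)) := by
    rw [← Real.exp_add, ← Real.exp_add]; congr 1; ring
  rw [e1, e2]
  calc _ ≤ exp (2 * (t' - t)) * exp t ^ 2 * (‖Xp t θ - x₀‖ ^ (2 * β)
        * exp ((t' - t) / δ * (2 * β)) * (exp (L / a * (t' - t)) * V (Xp t θ))) := by
        have : 0 ≤ V (Xp t' θ) := by linarith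
        gcongr
    _ = _ := by ring

/-- For negative exponents there is no solution of class `C²` up to the boundary. -/
lemma no_sol_neg {β a : ℝ} {x₀ : E2} {V u : E2 → ℝ} (hβ : β < 0) (ha : 0 < a) (hx₀ : ‖x₀‖ = 1/2)
    (hV : ∀ x ∈ closure Omega, a ≤ V x) (h : IsSolPbeta β x₀ V u) : False := by
  obtain ⟨hu, hfr, heq⟩ := h
  obtain ⟨M, hM⟩ := isCompact_clOmega.exists_bound_of_continuousOn
    (hu.continuousOn_iteratedFDerivWithin (m := 2) le_rfl uniqueDiff_clOmega)
  obtain ⟨m, hm⟩ := isCompact_clOmega.exists_bound_of_continuousOn hu.continuousOn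
  have hlap : ∀ x ∈ Omega, |lap u x| ≤ 2 * M := by
    intro x hx
    have c2 := (sol_fderiv hu hx).1
    have e := iteratedFDerivWithin_eq_iteratedFDeriv (n := 2) uniqueDiff_clOmega c2
      (subset_closure hx)
    have b : ‖iteratedFDeriv ℝ 2 u x‖ ≤ M := by rw [← e]; exact hM x (subset_closure hx)
    have one : ∀ i : Fin 2, |iteratedFDeriv ℝ 2 u x
        ![EuclideanSpace.single i 1, EuclideanSpace.single i 1]| ≤ M := by
      intro i
      have := (iteratedFDeriv ℝ 2 u x).le_opNorm
        ![EuclideanSpace.single i 1, EuclideanSpace.single i 1]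
      rw [Real.norm_eq_abs] at this
      refine (this.trans_eq ?_).trans b
      simp [Fin.prod_univ_two]
    unfold lap
    rw [Fin.sum_univ_two]
    refine (abs_add_le _ _).trans ?_
    linarith [one 0, one 1]
  have T := tendsto_rpow_neg_nhdsGT_zero (y := 2 * β) (by linarith)
  have ev := (T.eventually_gt_atTop (2 * M / (a * exp (-m)))).and
    (Ioo_mem_nhdsGT (show (0:ℝ) < 1/2 by norm_num))
  obtain ⟨z, hz1, hz2⟩ := ev.exists
  set x : E2 := (1 + 2 * z) • x₀ with hx
  have nx : ‖x‖ = 1/2 + z := by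
    rw [hx, norm_smul, hx₀, Real.norm_of_nonneg (by linarith [hz2.1])]; ring
  have nd : ‖x - x₀‖ = z := by
    have : x - x₀ = (2 * z) • x₀ := by rw [hx]; module
    rw [this, norm_smul, hx₀, Real.norm_of_nonneg (by linarith [hz2.1])]; ring
  have xO : x ∈ Omega := by
    show 1/2 < ‖x‖ ∧ ‖x‖ < 1
    rw [nx]; constructor <;> linarith [hz2.1, hz2.2]
  have e := heq x xO
  rw [nd] at e
  have l := neg_le_of_abs_le (hlap x xO)
  have v := hV x (subset_closure xO)
  have w : exp (-m) ≤ exp (u x) := Real.exp_le_exp.2 (neg_le_of_abs_le (hm x (subset_closure xO)))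
  rw [div_lt_iff₀ (by positivity)] at hz1
  have zp : 0 < z ^ (2 * β) := Real.rpow_pos_of_pos hz2.1 _
  have : z ^ (2 * β) * (a * exp (-m)) ≤ z ^ (2 * β) * V x * exp (u x) := by
    rw [← mul_assoc]
    gcongr
    exact mul_nonneg zp.le (by linarith)
  linarith

lemma gradient_le {u : E2 → ℝ} {x : E2} (hx : x ∈ closure Omega) (v : E2) :
    |⟪gradient u x, v⟫| ≤ |fderivWithin ℝ u (closure Omega) x v| := by
  have e : ⟪gradient u x, v⟫ = fderiv ℝ u x v := by
    unfold gradient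
    exact InnerProductSpace.toDual_symm_apply
  rw [e]
  by_cases hd : DifferentiableAt ℝ u x
  · rw [hd.fderivWithin (uniqueDiff_clOmega x hx)]
  · rw [fderiv_zero_of_not_differentiableAt hd]
    simp

theorem bounds_of_nonneg (β a : ℝ) (hβ : 0 ≤ β) (ha : 0 < a) :
    ∃ C > (0:ℝ), ∀ (x₀ : E2), ‖x₀‖ = 1/2 →
      ∀ V u : E2 → ℝ,
        LipschitzOnWith (Real.toNNReal ((β + 1) * a / 2)) V (closure Omega) →
        (∀ x ∈ closure Omega, a ≤ V x) →
        IsSolPbeta β x₀ V u →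
        mI (fun t θ => fderivWithin ℝ u (closure Omega) (Xp t θ) (Xp t θ) ^ 2) (-Real.log 2) ≤ C ∧
        mI (fun t θ => fderivWithin ℝ u (closure Omega) (Xp t θ) (Xp t θ) ^ 2) 0 ≤ C := by
  set A := -Real.log 2 with hA
  have l2 : (0:ℝ) < Real.log 2 := Real.log_pos (by norm_num)
  have hAB : A < 0 := by linarith
  set L := (β + 1) * a / 2 with hL
  have L0 : 0 ≤ L := by positivity
  set s := A + (0 - A) / 4 with hs
  set S := (0:ℝ) - (0 - A) / 4 with hS
  have hAs : A < s := by linarith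
  set δ := exp s - 1/2 with hδ
  have δ0 : 0 < δ := by
    have : exp A < exp s := Real.exp_lt_exp.2 hAs
    rw [exp_logA] at this
    linarith
  set g := (1/2) ^ 2 * (δ ^ (2 * β) * a) with hg
  have g0 : 0 < g := by positivity
  obtain ⟨C1, hC1⟩ := strip_main (c := L / a) hAB g0 (by positivity)
  obtain ⟨C2, hC2⟩ := strip_main (c := 2 + L / a + 2 * β / δ) hAB g0 (by positivity)
  refine ⟨|C1| + |C2| + 1, by positivity, ?_⟩
  intro x₀ hx₀ V u hlip hV hsol
  have st := sol_strip hβ hlip.continuousOn (fun x hx => ha.trans_le (hV x hx)) hx₀ hsol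
  have glow : ∀ t ∈ Icc s S, ∀ θ, g ≤ exp t ^ 2 * (‖Xp t θ - x₀‖ ^ (2 * β) * V (Xp t θ)) := by
    intro t ht θ
    have mt : t ∈ Icc A 0 := ⟨by linarith [ht.1], by linarith [ht.2]⟩
    have h1 : 1/2 ≤ exp t := by rw [← exp_logA]; exact Real.exp_le_exp.2 mt.1
    have h2 := dist_low hx₀ ht.1 θ
    have h3 := hV _ (Xp_mem_cl mt θ)
    have h4 : δ ^ (2 * β) ≤ ‖Xp t θ - x₀‖ ^ (2 * β) :=
      Real.rpow_le_rpow δ0.le h2 (by positivity)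
    rw [hg]
    gcongr
  have b1 := hC1 _ _ _ _ _ _ _ st glow (fun θ =>
    (G_mono_in hβ ha hx₀ L0 hlip hV θ).mono (Icc_subset_Icc le_rfl (by linarith)))
  have b2 := hC2 _ _ _ _ _ _ _ st.reflect
    (fun t ht θ => glow (A + 0 - t) ⟨by linarith [ht.2], by linarith [ht.1]⟩ θ) (by
      intro θ t ht t' ht' htt
      simp only
      have r := G_ratio_out (s := s) (t := A + 0 - t') (t' := A + 0 - t) hβ ha hx₀ L0 hlip hV θ hAs
        (by linarith [ht'.2]) (by linarith) (by linarith [ht.1])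
      refine (mul_le_mul_of_nonneg_left r (exp_pos _).le).trans_eq ?_
      rw [← mul_assoc, ← Real.exp_add]
      congr 2
      ring)
  constructor
  · have := le_abs_self C1
    have := abs_nonneg C2
    linarith
  · have e : mI (fun t θ => (-fderivWithin ℝ u (closure Omega) (Xp (A + 0 - t) θ)
        (Xp (A + 0 - t) θ)) ^ 2) A
        = mI (fun t θ => fderivWithin ℝ u (closure Omega) (Xp t θ) (Xp t θ) ^ 2) 0 := by
      unfold mI
      simp only [neg_sq, add_zero, sub_self]
    rw [e] at b2
    have := le_abs_self C2
    have := abs_nonneg C1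
    linarith

/-- Uniform boundary estimates for solutions of (P_β) with `V` Lipschitz with constant
`≤ (β+1) a / 2`: `∫_{C(1)} (∂_ν u)² dσ ≤ C`, `|∫_{C(1)} ∂_ν u dσ| ≤ C` and
`|∫_{C(1/2)} ∂_ν u dσ| ≤ C`, where `ν(x) = x` on `C(1)` and `ν(x) = -2x` on `C(1/2)`. -/
theorem boundary_bounds_Pbeta (β a b : ℝ) (hβ : -(1/2) < β) (ha : 0 < a) (hab : a ≤ b) :
    ∃ C > (0:ℝ), ∀ (x₀ : E2), ‖x₀‖ = 1/2 →
      ∀ V u : E2 → ℝ,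
        LipschitzOnWith (Real.toNNReal ((β + 1) * a / 2)) V (closure Omega) →
        (∀ x ∈ closure Omega, a ≤ V x ∧ V x ≤ b) →
        IsSolPbeta β x₀ V u →
        circleIntR (fun x => ⟪gradient u x, x⟫ ^ 2) 1 ≤ C ∧
        |circleIntR (fun x => ⟪gradient u x, x⟫) 1| ≤ C ∧
        |circleIntR (fun x => ⟪gradient u x, (-2 : ℝ) • x⟫) (1/2)| ≤ C := by
  rcases lt_or_ge β 0 with hneg | hpos
  · refine ⟨1, one_pos, ?_⟩
    intro x₀ hx₀ V u _ hV hsol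
    exact (no_sol_neg hneg ha hx₀ (fun x hx => (hV x hx).1) hsol).elim
  obtain ⟨C, hC, H⟩ := bounds_of_nonneg β a hpos ha
  refine ⟨C + 2 * π, by positivity, ?_⟩
  intro x₀ hx₀ V u hlip hV hsol
  obtain ⟨bA, bB⟩ := H x₀ hx₀ V u hlip (fun x hx => (hV x hx).1) hsol
  have st := sol_strip hpos hlip.continuousOn (fun x hx => ha.trans_le (hV x hx).1) hx₀ hsol
  have l2 : (0:ℝ) < Real.log 2 := Real.log_pos (by norm_num)
  have mA : -Real.log 2 ∈ Icc (-Real.log 2) 0 := ⟨le_rfl, by linarith⟩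
  have mB : (0:ℝ) ∈ Icc (-Real.log 2) 0 := ⟨by linarith, le_rfl⟩
  have cA := strip_slice st.cUt mA
  have cB := strip_slice st.cUt mB
  have eA : ∀ θ, circlePt (1/2) θ = Xp (-Real.log 2) θ := fun θ => by rw [Xp, exp_logA]
  have eB : ∀ θ, circlePt 1 θ = Xp 0 θ := fun θ => by rw [Xp, Real.exp_zero]
  have hπ := Real.pi_pos
  have lin : ∀ f : ℝ → ℝ, Continuous f → ∫ θ in (0:ℝ)..(2 * π), (f θ ^ 2 + 1)
      = (∫ θ in (0:ℝ)..(2 * π), f θ ^ 2) + 2 * π := by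
    intro f hf
    rw [intervalIntegral.integral_add (Continuous.intervalIntegrable (by fun_prop) _ _) (by simp)]
    simp
  have absle : ∀ y : ℝ, |y| ≤ y ^ 2 + 1 := fun y => by
    rw [← sq_abs]; nlinarith [sq_nonneg (|y| - 1), abs_nonneg y]
  refine ⟨?_, ?_, ?_⟩
  · have h1 : ‖circleIntR (fun x => ⟪gradient u x, x⟫ ^ 2) 1‖
        ≤ ∫ θ in (0:ℝ)..(2 * π), (fderivWithin ℝ u (closure Omega) (Xp 0 θ) (Xp 0 θ)) ^ 2 := by
      unfold circleIntR
      refine intervalIntegral.norm_integral_le_of_norm_le (by positivity) ?_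
        ((cB.pow 2).intervalIntegrable _ _)
      refine Eventually.of_forall fun θ _ => ?_
      rw [mul_one, eB, norm_pow, Real.norm_eq_abs, ← sq_abs (fderivWithin _ _ _ _ _)]
      exact pow_le_pow_left₀ (abs_nonneg _) (gradient_le (Xp_mem_cl mB θ) _) 2
    have h2 := le_abs_self (circleIntR (fun x => ⟪gradient u x, x⟫ ^ 2) 1)
    rw [Real.norm_eq_abs] at h1
    unfold mI at bB
    linarith
  · have h1 : ‖circleIntR (fun x => ⟪gradient u x, x⟫) 1‖
        ≤ ∫ θ in (0:ℝ)..(2 * π),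
          ((fderivWithin ℝ u (closure Omega) (Xp 0 θ) (Xp 0 θ)) ^ 2 + 1) := by
      unfold circleIntR
      refine intervalIntegral.norm_integral_le_of_norm_le (by positivity) ?_
        (((cB.pow 2).add continuous_const).intervalIntegrable _ _)
      refine Eventually.of_forall fun θ _ => ?_
      rw [mul_one, eB, Real.norm_eq_abs]
      exact (gradient_le (Xp_mem_cl mB θ) _).trans (absle _)
    rw [lin _ cB, Real.norm_eq_abs] at h1
    unfold mI at bB
    linarith
  · have h1 : ‖circleIntR (fun x => ⟪gradient u x, (-2 : ℝ) • x⟫) (1/2)‖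
        ≤ ∫ θ in (0:ℝ)..(2 * π), ((fderivWithin ℝ u (closure Omega) (Xp (-Real.log 2) θ)
          (Xp (-Real.log 2) θ)) ^ 2 + 1) := by
      unfold circleIntR
      refine intervalIntegral.norm_integral_le_of_norm_le (by positivity) ?_
        (((cA.pow 2).add continuous_const).intervalIntegrable _ _)
      refine Eventually.of_forall fun θ _ => ?_
      have e : ⟪gradient u (circlePt (1/2) θ), (-2 : ℝ) • circlePt (1/2) θ⟫ * (1/2)
          = - ⟪gradient u (circlePt (1/2) θ), circlePt (1/2) θ⟫ := by
        rw [real_inner_smul_right]; ring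
      rw [e, eA, norm_neg, Real.norm_eq_abs]
      exact (gradient_le (Xp_mem_cl mA θ) _).trans (absle _)
    rw [lin _ cA, Real.norm_eq_abs] at h1
    unfold mI at bA
    linarith
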